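/- arXiv:2303.05671 — 2 statements merged into one kernel-verified Lean document; each statement's English description precedes it below -/
import Mathlib

section
/- Let 1 ≤ r ≤ ∞, 1 ≤ p ≤ p₁ ≤ ∞ and define p₂ by 1/p₂ = 1/p − 1/p₁. There exists a constant C > 0 such that for all smooth v, f : 𝕋 → ℝ, the ℓ^r norm over j ≥ −1 of the sequence 2^j ‖[Δ_j, v]∂_x f‖_{L^p(𝕋)} is at most C ( ‖∂_x v‖_{L^∞(𝕋)} ‖f‖_{B^1_{p,r}(𝕋)} + ‖∂_x f‖_{L^{p₂}(𝕋)} ‖∂_x v‖_{B^0_{p₁,r}(𝕋)} ), where [Δ_j, v]∂_x f = Δ_j(v ∂_x f) − v Δ_j ∂_x f. -/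
open MeasureTheory Filter Function
open scoped ENNReal NNReal

noncomputable section

/-- The Fourier coefficient `û(ξ) = ∫_{-π}^{π} e^{-i x ξ} u(x) dx` of a `2π`-periodic
function on the torus. -/
def fCoeff (u : ℝ → ℂ) (ξ : ℤ) : ℂ :=
  ∫ x in (-Real.pi)..Real.pi, Complex.exp (-Complex.I * x * ξ) * u x

/-- A Littlewood–Paley cutoff function: smooth, even, `0 ≤ χ ≤ 1`, `χ = 1` on `[-3/4,3/4]`,
`supp χ ⊆ (-4/3, 4/3)`, nonincreasing on `[0,∞)`. -/
structure LPCutoff where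
  χ : ℝ → ℝ
  smooth : ContDiff ℝ (⊤ : ℕ∞) χ
  even : ∀ x, χ (-x) = χ x
  nonneg : ∀ x, 0 ≤ χ x
  le_one : ∀ x, χ x ≤ 1
  eq_one : ∀ x ∈ Set.Icc (-(3/4) : ℝ) (3/4 : ℝ), χ x = 1
  supp : ∀ x, χ x ≠ 0 → x ∈ Set.Ioo (-(4/3) : ℝ) (4/3 : ℝ)
  decay : AntitoneOn χ (Set.Ici 0)

/-- `φ(ξ) = χ(ξ/2) - χ(ξ)`. -/
def LPCutoff.phi (c : LPCutoff) (x : ℝ) : ℝ := c.χ (x / 2) - c.χ x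

/-- The dyadic block `Δ_j u` (for `j ≥ -1`). -/
def LPblock (c : LPCutoff) (j : ℤ) (u : ℝ → ℂ) (x : ℝ) : ℂ :=
  if j = -1 then
    (1 / (2 * Real.pi)) * ∑' ξ : ℤ, (c.χ ξ : ℂ) * fCoeff u ξ * Complex.exp (Complex.I * x * ξ)
  else
    (1 / (2 * Real.pi)) *
      ∑' ξ : ℤ, (c.phi ((2:ℝ) ^ (-j) * ξ) : ℂ) * fCoeff u ξ * Complex.exp (Complex.I * x * ξ)

/-- The low-frequency cut-off `S_j u`. -/
def LPlow (c : LPCutoff) (j : ℤ) (u : ℝ → ℂ) (x : ℝ) : ℂ :=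
  (1 / (2 * Real.pi)) *
    ∑' ξ : ℤ, (c.χ ((2:ℝ) ^ (-j) * ξ) : ℂ) * fCoeff u ξ * Complex.exp (Complex.I * x * ξ)

/-- The `L^∞(𝕋)` (sup) norm, with values in `ℝ≥0∞`. -/
def supNormE {E : Type*} [NormedAddCommGroup E] (f : ℝ → E) : ℝ≥0∞ :=
  ⨆ x : ℝ, (‖f x‖₊ : ℝ≥0∞)

/-- View a real-valued function as a complex-valued one. -/
def toC (f : ℝ → ℝ) : ℝ → ℂ := fun x => (f x : ℂ)

/-- The `L^p(𝕋)` norm, with values in `ℝ≥0∞`. -/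
def LpNormT (p : ℝ≥0∞) (f : ℝ → ℂ) : ℝ≥0∞ :=
  eLpNorm f p (volume.restrict (Set.Ioc (-Real.pi) Real.pi))

/-- The `ℓ^r` norm (over `j ≥ -1`, reindexed by `k = j + 1 ∈ ℕ`) of a sequence in `ℝ≥0∞`. -/
def lrNormE (r : ℝ≥0∞) (a : ℕ → ℝ≥0∞) : ℝ≥0∞ :=
  if r = ∞ then ⨆ k, a k else (∑' k, a k ^ r.toReal) ^ (1 / r.toReal)

/-- The `B^s_{p,r}(𝕋)` norm: the `ℓ^r` norm over `j ≥ -1` of `2^{js} ‖Δ_j u‖_{L^p}`. -/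
def besovNormE (c : LPCutoff) (s : ℝ) (p r : ℝ≥0∞) (u : ℝ → ℂ) : ℝ≥0∞ :=
  lrNormE r fun k =>
    ENNReal.ofReal ((2:ℝ) ^ (((k : ℝ) - 1) * s)) * LpNormT p (LPblock c ((k:ℤ) - 1) u)

/-- The commutator `[Δ_j, v] ∂_x f = Δ_j (v ∂_x f) - v Δ_j ∂_x f`. -/
def commutatorLP (c : LPCutoff) (j : ℤ) (v f : ℝ → ℝ) : ℝ → ℂ := fun x =>
  LPblock c j (toC fun y => v y * deriv f y) x - (v x : ℂ) * LPblock c j (toC (deriv f)) x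

lemma mink {α β : Type*} [MeasurableSpace α] [MeasurableSpace β] {μ : Measure α} {ν : Measure β}
    [SFinite μ] [IsFiniteMeasure ν] {p : ℝ≥0∞} (hp : 1 ≤ p) (F : α → β → ℝ≥0∞)
    (hF : Measurable (uncurry F)) (A : ℝ≥0∞)
    (hA : ∀ y, eLpNorm (fun x => F x y) p μ ≤ A) :
    eLpNorm (fun x => ∫⁻ y, F x y ∂ν) p μ ≤ ν Set.univ * A := by
  by_cases hpt : p = ∞
  · subst hpt
    simp only [eLpNorm_exponent_top, eLpNormEssSup, enorm_eq_self] at hA ⊢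
    have h1 : ∀ᵐ y ∂ν, ∀ᵐ x ∂μ, F x y ≤ A := by
      refine Eventually.of_forall fun y => ?_
      exact (ENNReal.ae_le_essSup (fun x => F x y)).mono fun x hx => hx.trans (hA y)
    have h2 : ∀ᵐ x ∂μ, ∀ᵐ y ∂ν, F x y ≤ A := by
      rw [Measure.ae_ae_comm]
      · exact h1
      · exact measurableSet_le hF measurable_const
    refine essSup_le_of_ae_le _ ?_
    filter_upwards [h2] with x hx
    calc ∫⁻ y, F x y ∂ν ≤ ∫⁻ y, A ∂ν := lintegral_mono_ae hx
      _ = ν Set.univ * A := by rw [lintegral_const, mul_comm]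
  · have hp0 : p ≠ 0 := (zero_lt_one.trans_le hp).ne'
    have hq1 : 1 ≤ p.toReal := by
      rw [← ENNReal.toReal_one]
      exact ENNReal.toReal_mono hpt hp
    have hq0 : 0 < p.toReal := by linarith
    have key : ∀ x, (∫⁻ y, F x y ∂ν) ^ p.toReal ≤
        (ν Set.univ) ^ (p.toReal - 1) * ∫⁻ y, F x y ^ p.toReal ∂ν := by
      intro x
      have hm : Measurable (F x) := hF.of_uncurry_left
      have h := eLpNorm_le_eLpNorm_mul_rpow_measure_univ (μ := ν) (f := F x) hp
        hm.aestronglyMeasurable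
      rw [eLpNorm_one_eq_lintegral_enorm, eLpNorm_eq_lintegral_rpow_enorm_toReal hp0 hpt] at h
      simp only [enorm_eq_self] at h
      calc (∫⁻ y, F x y ∂ν) ^ p.toReal ≤ _ := ENNReal.rpow_le_rpow h hq0.le
        _ = _ := by
          rw [ENNReal.mul_rpow_of_nonneg _ _ hq0.le, ← ENNReal.rpow_mul, ← ENNReal.rpow_mul,
            one_div_mul_cancel hq0.ne', ENNReal.rpow_one, mul_comm]
          congr 2
          simp
          field_simp
    rw [eLpNorm_eq_lintegral_rpow_enorm_toReal hp0 hpt]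
    simp only [enorm_eq_self]
    have hA' : ∀ y, ∫⁻ x, F x y ^ p.toReal ∂μ ≤ A ^ p.toReal := by
      intro y
      have := hA y
      rw [eLpNorm_eq_lintegral_rpow_enorm_toReal hp0 hpt] at this
      simp only [enorm_eq_self] at this
      have h := ENNReal.rpow_le_rpow this hq0.le
      rwa [← ENNReal.rpow_mul, one_div_mul_cancel hq0.ne', ENNReal.rpow_one] at h
    have h3 : ∫⁻ x, (∫⁻ y, F x y ∂ν) ^ p.toReal ∂μ ≤ (ν Set.univ * A) ^ p.toReal := by
      calc _ ≤ ∫⁻ x, (ν Set.univ) ^ (p.toReal - 1) * ∫⁻ y, F x y ^ p.toReal ∂ν ∂μ :=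
            lintegral_mono key
        _ = (ν Set.univ) ^ (p.toReal - 1) * ∫⁻ x, ∫⁻ y, F x y ^ p.toReal ∂ν ∂μ := by
            rw [lintegral_const_mul']
            exact ENNReal.rpow_ne_top_of_nonneg (by linarith) (measure_ne_top _ _)
        _ = (ν Set.univ) ^ (p.toReal - 1) * ∫⁻ y, ∫⁻ x, F x y ^ p.toReal ∂μ ∂ν := by
            rw [lintegral_lintegral_swap]
            exact (hF.pow_const _).aemeasurable
        _ ≤ (ν Set.univ) ^ (p.toReal - 1) * ∫⁻ y, A ^ p.toReal ∂ν := by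
            gcongr with y
            exact hA' y
        _ = (ν Set.univ * A) ^ p.toReal := by
            rw [lintegral_const, ENNReal.mul_rpow_of_nonneg _ _ hq0.le, mul_comm (A ^ _), ← mul_assoc]
            congr 1
            nth_rewrite 2 [← ENNReal.rpow_one (ν Set.univ)]
            rw [← ENNReal.rpow_add_of_nonneg _ _ (by linarith) (by linarith)]
            congr 1
            ring
    calc _ ≤ ((ν Set.univ * A) ^ p.toReal) ^ (1 / p.toReal) :=
          ENNReal.rpow_le_rpow h3 (by positivity)
      _ = _ := by
        rw [← ENNReal.rpow_mul, mul_one_div_cancel hq0.ne', ENNReal.rpow_one]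

lemma exists_kernel (m : ℝ → ℂ) (hm : ContDiff ℝ (⊤ : ℕ∞) m) (hc : HasCompactSupport m) :
    ∃ h : ℝ → ℂ, Continuous h ∧ Integrable h ∧ Integrable (fun y : ℝ => (y : ℂ) * h y) ∧
      ∀ ξ : ℝ, ∫ y, h y * Complex.exp (-Complex.I * y * ξ) = m ξ := by
  have hm2 : ContDiff ℝ (⊤ : ℕ∞) (fun x : ℝ => m (2 * Real.pi * x)) :=
    hm.comp (contDiff_const.mul contDiff_id)
  have hc2 : HasCompactSupport (fun x : ℝ => m (2 * Real.pi * x)) := by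
    have := hc.comp_homeomorph (Homeomorph.mulLeft₀ (2 * Real.pi) (by positivity))
    exact this
  let M : SchwartzMap ℝ ℂ := hc2.toSchwartzMap hm2
  let h : SchwartzMap ℝ ℂ := FourierTransform.fourierInv M
  refine ⟨h, h.continuous, h.integrable, ?_, ?_⟩
  · have h1 := (SchwartzMap.integrable_pow_mul volume h 1)
    refine (integrable_norm_iff ?_).1 (h1.congr (Eventually.of_forall fun y => by simp))
    exact (Complex.continuous_ofReal.mul h.continuous).aestronglyMeasurable
  · intro ξ
    have h2 : FourierTransform.fourier h = M := FourierTransform.fourier_fourierInv_eq M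
    have h3 := congrArg (fun g : SchwartzMap ℝ ℂ => g (ξ / (2 * Real.pi))) h2
    simp only [SchwartzMap.fourier_coe] at h3
    have h4 : M (ξ / (2 * Real.pi)) = m ξ := by
      change m (2 * Real.pi * (ξ / (2 * Real.pi))) = m ξ
      congr 1
      field_simp
    rw [h4, Real.fourier_real_eq_integral_exp_smul] at h3
    rw [← h3]
    congr 1
    ext y
    rw [smul_eq_mul, mul_comm]
    congr 2
    push_cast
    field_simp

def ex (ξ : ℤ) (x : ℝ) : ℂ := Complex.exp (Complex.I * x * ξ)

def Kop (h : ℝ → ℂ) (l : ℝ) (u : ℝ → ℂ) (x : ℝ) : ℂ := ∫ y, h y * u (x - l * y)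

structure SP (u : ℝ → ℂ) : Prop where
  smooth : ContDiff ℝ (⊤ : ℕ∞) u
  per : Function.Periodic u (2 * Real.pi)

structure IsKer (h m : ℝ → ℂ) : Prop where
  cont : Continuous h
  int : Integrable h
  int1 : Integrable (fun y : ℝ => (y : ℂ) * h y)
  ft : ∀ ξ : ℝ, ∫ y, h y * Complex.exp (-Complex.I * y * ξ) = m ξ

lemma norm_ex (ξ : ℤ) (x : ℝ) : ‖ex ξ x‖ = 1 := by
  have : Complex.I * x * ξ = ((x * ξ : ℝ) : ℂ) * Complex.I := by push_cast; ring
  rw [ex, this, Complex.norm_exp_ofReal_mul_I]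

lemma ex_smooth (ξ : ℤ) : ContDiff ℝ (⊤ : ℕ∞) (ex ξ) := by
  unfold ex
  exact ((contDiff_const.mul Complex.ofRealCLM.contDiff).mul contDiff_const).cexp

lemma ex_per (ξ : ℤ) : Function.Periodic (ex ξ) (2 * Real.pi) := by
  intro x
  unfold ex
  have : Complex.I * ((x + 2 * Real.pi : ℝ) : ℂ) * ξ = Complex.I * x * ξ + ξ * (2 * Real.pi * Complex.I) := by
    push_cast; ring
  rw [this, Complex.exp_add, Complex.exp_int_mul_two_pi_mul_I, mul_one]

lemma ex_SP (ξ : ℤ) : SP (ex ξ) := ⟨ex_smooth ξ, ex_per ξ⟩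

lemma ex_hasDerivAt (ξ : ℤ) (x : ℝ) : HasDerivAt (ex ξ) (Complex.I * ξ * ex ξ x) x := by
  unfold ex
  have h1 : HasDerivAt (fun x : ℝ => Complex.I * (x : ℂ) * ξ) (Complex.I * ξ) x := by
    have := ((Complex.ofRealCLM.hasDerivAt (x := x)).const_mul Complex.I).mul_const (ξ : ℂ)
    simpa using this
  simpa [mul_comm] using h1.cexp

lemma ex_mul (ξ η : ℤ) (x : ℝ) : ex ξ x * ex η x = ex (ξ + η) x := by
  unfold ex
  rw [← Complex.exp_add]
  congr 1
  push_cast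
  ring

lemma fCoeff_eq (u : ℝ → ℂ) (ξ : ℤ) :
    fCoeff u ξ = ∫ x in (-Real.pi)..Real.pi, ex (-ξ) x * u x := by
  unfold fCoeff ex
  congr 1
  ext x
  congr 2
  push_cast
  ring

lemma Kop_ex {h m : ℝ → ℂ} (hk : IsKer h m) (l : ℝ) (ξ : ℤ) (x : ℝ) :
    Kop h l (ex ξ) x = m (l * ξ) * ex ξ x := by
  unfold Kop
  rw [← hk.ft, ← integral_mul_const]
  congr 1
  ext y
  unfold ex
  rw [mul_assoc (h y), ← Complex.exp_add]
  congr 2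
  push_cast
  ring

lemma SP.deriv {u : ℝ → ℂ} (hu : SP u) : SP (deriv u) := by
  refine ⟨?_, ?_⟩
  · exact (contDiff_infty_iff_deriv.1 hu.smooth).2
  · intro x
    have : u = fun x => u (x + 2 * Real.pi) := by ext x; exact (hu.per x).symm
    conv_rhs => rw [this]
    rw [deriv_comp_add_const]

lemma SP.diff {u : ℝ → ℂ} (hu : SP u) : Differentiable ℝ u :=
  hu.smooth.differentiable (by simp)

lemma SP.cont {u : ℝ → ℂ} (hu : SP u) : Continuous u := hu.smooth.continuous

lemma fCoeff_deriv {u : ℝ → ℂ} (hu : SP u) (ξ : ℤ) :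
    fCoeff (_root_.deriv u) ξ = Complex.I * ξ * fCoeff u ξ := by
  rw [fCoeff_eq, fCoeff_eq]
  rw [intervalIntegral.integral_mul_deriv_eq_deriv_mul (u := ex (-ξ)) (v := u)
    (u' := fun x => Complex.I * (-ξ : ℤ) * ex (-ξ) x) (v' := _root_.deriv u)
    (fun x _ => ex_hasDerivAt _ x) (fun x _ => (hu.diff x).hasDerivAt)]
  · have h1 : ex (-ξ) Real.pi = ex (-ξ) (-Real.pi) := by
      rw [← ex_per (-ξ) (-Real.pi)]; congr 1; ring
    have h2 : u Real.pi = u (-Real.pi) := by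
      rw [← hu.per (-Real.pi)]; congr 1; ring
    rw [h1, h2, sub_self, zero_sub, ← intervalIntegral.integral_neg,
      ← intervalIntegral.integral_const_mul]
    congr 1
    ext x
    push_cast
    ring
  · exact (continuous_const.mul (ex_smooth _).continuous).intervalIntegrable _ _
  · exact hu.deriv.cont.intervalIntegrable _ _

lemma fCoeff_bdd {u : ℝ → ℂ} (hu : Continuous u) : ∃ M : ℝ, ∀ ξ, ‖fCoeff u ξ‖ ≤ M := by
  refine ⟨∫ x in (-Real.pi)..Real.pi, ‖u x‖, fun ξ => ?_⟩
  rw [fCoeff_eq]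
  refine (intervalIntegral.norm_integral_le_integral_norm (by linarith [Real.pi_pos])).trans ?_
  apply le_of_eq
  congr 1
  ext x
  rw [norm_mul, norm_ex, one_mul]

lemma fCoeff_summable {u : ℝ → ℂ} (hu : SP u) : Summable (fCoeff u) := by
  obtain ⟨M, hM⟩ := fCoeff_bdd hu.deriv.deriv.cont
  have hs : Summable (fun ξ : ℤ => M * (1 / (ξ : ℝ) ^ 2)) :=
    (Real.summable_one_div_int_pow.2 one_lt_two).mul_left M
  refine Summable.of_norm_bounded_eventually hs ?_
  have : ({0} : Set ℤ).Finite := Set.finite_singleton 0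
  filter_upwards [this.compl_mem_cofinite] with ξ hξ
  have h0 : (ξ : ℝ) ≠ 0 := by simpa using hξ
  have h := hM ξ
  rw [fCoeff_deriv hu.deriv, fCoeff_deriv hu] at h
  simp only [norm_mul, Complex.norm_I, one_mul, Complex.norm_intCast] at h
  rw [mul_one_div, le_div_iff₀ (by positivity), ← sq_abs]
  nlinarith

lemma fourier_inv {u : ℝ → ℂ} (hu : SP u) (x : ℝ) :
    HasSum (fun ξ : ℤ => (1 / (2 * Real.pi) : ℂ) * fCoeff u ξ * ex ξ x) (u x) := by
  have : Fact (0 < 2 * Real.pi) := ⟨Real.two_pi_pos⟩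
  have hcont : Continuous hu.per.lift := by
    exact continuous_coinduced_dom.mpr hu.cont
  let F : C(AddCircle (2 * Real.pi), ℂ) := ⟨hu.per.lift, hcont⟩
  have hF : ∀ y : ℝ, F (y : AddCircle (2 * Real.pi)) = u y := fun y => hu.per.lift_coe y
  have hfour : ∀ (n : ℤ) (y : ℝ), fourier n (y : AddCircle (2 * Real.pi)) = ex n y := by
    intro n y
    rw [fourier_coe_apply]
    unfold ex
    congr 1
    push_cast
    have : (Real.pi : ℂ) ≠ 0 := by exact_mod_cast Real.pi_ne_zero
    field_simp
  have hco : ∀ n, fourierCoeff F n = (1 / (2 * Real.pi) : ℂ) * fCoeff u n := by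
    intro n
    rw [fourierCoeff_eq_intervalIntegral F n (-Real.pi), fCoeff_eq]
    have : -Real.pi + 2 * Real.pi = Real.pi := by ring
    rw [this]
    simp only [hfour, hF, smul_eq_mul, Complex.real_smul]
    push_cast
    rfl
  have hsum : Summable (fourierCoeff F) := by
    have : fourierCoeff F = fun n => (1 / (2 * Real.pi) : ℂ) * fCoeff u n := funext hco
    rw [this]
    exact (fCoeff_summable hu).mul_left _
  have := has_pointwise_sum_fourier_series_of_summable hsum (x : AddCircle (2 * Real.pi))
  rw [hF] at this
  simpa only [hco, hfour, smul_eq_mul] using this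

lemma Kop_fourier {h m : ℝ → ℂ} (hk : IsKer h m) (l : ℝ) {u : ℝ → ℂ} (hu : SP u) (x : ℝ) :
    Kop h l u x = (1 / (2 * Real.pi) : ℂ) * ∑' ξ : ℤ, m (l * ξ) * fCoeff u ξ * ex ξ x := by
  set a : ℤ → ℂ := fun ξ => (1 / (2 * Real.pi) : ℂ) * fCoeff u ξ with ha
  have hint : ∀ ξ, Integrable (fun y => h y * (a ξ * ex ξ (x - l * y))) := by
    intro ξ
    refine hk.int.mul_bdd (c := ‖a ξ‖) ?_ ?_
    · have := (ex_smooth ξ).continuous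
      exact Continuous.aestronglyMeasurable (by fun_prop)
    · exact Eventually.of_forall fun y => by rw [norm_mul, norm_ex, mul_one]
  have hs := hasSum_integral_of_summable_integral_norm hint (by
    simp only [norm_mul, norm_ex, mul_one]
    simp_rw [integral_mul_const]
    exact ((fCoeff_summable hu).mul_left _).norm.mul_left _)
  have h1 : ∀ y, ∑' ξ, h y * (a ξ * ex ξ (x - l * y)) = h y * u (x - l * y) := by
    intro y
    rw [tsum_mul_left, (fourier_inv hu _).tsum_eq]
  have h2 : ∀ ξ, ∫ y, h y * (a ξ * ex ξ (x - l * y)) = a ξ * (m (l * ξ) * ex ξ x) := by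
    intro ξ
    rw [← Kop_ex hk, Kop, ← integral_const_mul]
    congr 1
    ext y
    ring
  simp only [h1, h2] at hs
  rw [Kop, ← hs.tsum_eq, ← tsum_mul_left]
  congr 1
  ext ξ
  rw [ha]
  ring

abbrev muT : Measure ℝ := volume.restrict (Set.Ioc (-Real.pi) Real.pi)

lemma SP.bdd {u : ℝ → ℂ} (hu : SP u) : ∃ M : ℝ, ∀ x, ‖u x‖ ≤ M := by
  have h := hu.per.isBounded_of_continuous (by positivity) hu.cont
  obtain ⟨M, hM⟩ := h.exists_norm_le
  exact ⟨M, fun x => hM _ ⟨x, rfl⟩⟩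

lemma SP.aesm {u : ℝ → ℂ} (hu : SP u) (μ : Measure ℝ) : AEStronglyMeasurable u μ :=
  hu.cont.aestronglyMeasurable

lemma Kop_int {h m : ℝ → ℂ} (hk : IsKer h m) (l : ℝ) {u : ℝ → ℂ} (hu : SP u) (x : ℝ) :
    Integrable (fun y => h y * u (x - l * y)) := by
  obtain ⟨M, hM⟩ := hu.bdd
  refine hk.int.mul_bdd (c := M) ?_ (Eventually.of_forall fun y => hM _)
  have := hu.cont
  exact Continuous.aestronglyMeasurable (by fun_prop)

lemma LpNormT_shift {u : ℝ → ℂ} (hu : SP u) (p : ℝ≥0∞) (c : ℝ) :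
    LpNormT p (fun x => u (x - c)) = LpNormT p u := by
  have : Fact (0 < 2 * Real.pi) := ⟨Real.two_pi_pos⟩
  have hcont : Continuous hu.per.lift := continuous_coinduced_dom.mpr hu.cont
  have hmp := AddCircle.measurePreserving_mk (2 * Real.pi) (-Real.pi)
  have e : -Real.pi + 2 * Real.pi = Real.pi := by ring
  rw [e] at hmp
  have h1 : u = hu.per.lift ∘ ((↑) : ℝ → AddCircle (2 * Real.pi)) := by
    ext x; exact (hu.per.lift_coe x).symm
  have h2 : (fun x => u (x - c)) = (hu.per.lift ∘ fun z => z - (c : AddCircle (2 * Real.pi))) ∘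
      ((↑) : ℝ → AddCircle (2 * Real.pi)) := by
    ext x
    exact (hu.per.lift_coe (x - c)).symm
  unfold LpNormT
  rw [h2]
  conv_rhs => rw [h1]
  have hc2 : Continuous (hu.per.lift ∘ fun z => z - (c : AddCircle (2 * Real.pi))) :=
    hcont.comp (continuous_id.sub continuous_const)
  rw [eLpNorm_comp_measurePreserving hc2.aestronglyMeasurable hmp,
    eLpNorm_comp_measurePreserving hcont.aestronglyMeasurable hmp,
    eLpNorm_comp_measurePreserving hcont.aestronglyMeasurable (measurePreserving_sub_right _ _)]

lemma young {k : ℝ → ℂ} (hkc : Continuous k) (hki : Integrable k) {u : ℝ → ℂ} (hu : SP u)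
    {p : ℝ≥0∞} (hp : 1 ≤ p) (l : ℝ) :
    eLpNorm (fun x => ∫⁻ y, ‖k y‖ₑ * ‖u (x - l * y)‖ₑ) p muT ≤
      (∫⁻ y, ‖k y‖ₑ) * LpNormT p u := by
  have hfin : ∫⁻ y, ‖k y‖ₑ ≠ ∞ := hki.2.ne
  have : IsFiniteMeasure (volume.withDensity fun y => ‖k y‖ₑ) := isFiniteMeasure_withDensity hfin
  have huc := hu.cont
  have h := mink (μ := muT) (ν := volume.withDensity fun y => ‖k y‖ₑ) hp
    (fun x y => ‖u (x - l * y)‖ₑ) (by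
      apply Measurable.enorm
      exact Continuous.measurable (by fun_prop)) (LpNormT p u) (by
      intro y
      rw [← LpNormT_shift hu p (l * y)]
      exact eLpNorm_mono_enorm fun x => by simp)
  rw [withDensity_apply _ MeasurableSet.univ, Measure.restrict_univ] at h
  refine le_trans (le_of_eq ?_) h
  congr 1
  ext x
  rw [lintegral_withDensity_eq_lintegral_mul]
  · rfl
  · exact hkc.measurable.enorm
  · apply Measurable.enorm
    exact Continuous.measurable (by fun_prop)

lemma Kop_Lp {h m : ℝ → ℂ} (hk : IsKer h m) (l : ℝ) {u : ℝ → ℂ} (hu : SP u) {p : ℝ≥0∞}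
    (hp : 1 ≤ p) : LpNormT p (Kop h l u) ≤ (∫⁻ y, ‖h y‖ₑ) * LpNormT p u := by
  refine le_trans (eLpNorm_mono_enorm fun x => ?_) (young hk.cont hk.int hu hp l)
  rw [enorm_eq_self]
  refine (enorm_integral_le_lintegral_enorm _).trans (le_of_eq ?_)
  congr 1
  ext y
  rw [enorm_mul]

lemma SP.toC {v : ℝ → ℝ} (hv : ContDiff ℝ (⊤ : ℕ∞) v) (hp : Function.Periodic v (2 * Real.pi)) :
    SP (toC v) :=
  ⟨Complex.ofRealCLM.contDiff.comp hv, fun x => by simp [_root_.toC, hp x]⟩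

lemma SP.mul {u w : ℝ → ℂ} (hu : SP u) (hw : SP w) : SP (fun x => u x * w x) :=
  ⟨hu.smooth.mul hw.smooth, fun x => by simp only [hu.per x, hw.per x]⟩

lemma SP.sub {u w : ℝ → ℂ} (hu : SP u) (hw : SP w) : SP (fun x => u x - w x) :=
  ⟨hu.smooth.sub hw.smooth, fun x => by simp only [hu.per x, hw.per x]⟩

lemma SP.add {u w : ℝ → ℂ} (hu : SP u) (hw : SP w) : SP (fun x => u x + w x) :=
  ⟨hu.smooth.add hw.smooth, fun x => by simp only [hu.per x, hw.per x]⟩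

lemma SP.const (a : ℂ) : SP (fun _ => a) := ⟨contDiff_const, fun _ => rfl⟩

lemma SP.sum {ι : Type*} (s : Finset ι) {u : ι → ℝ → ℂ} (hu : ∀ i ∈ s, SP (u i)) :
    SP (fun x => ∑ i ∈ s, u i x) :=
  ⟨ContDiff.sum fun i hi => (hu i hi).smooth,
    fun x => Finset.sum_congr rfl fun i hi => (hu i hi).per x⟩

lemma Kop_comm {h m : ℝ → ℂ} (hk : IsKer h m) {l : ℝ} (hl : 0 ≤ l) {v g : ℝ → ℂ} (hv : SP v)
    (hg : SP g) {V : ℝ≥0} (hV : ∀ x, ‖deriv v x‖₊ ≤ V) {p : ℝ≥0∞} (hp : 1 ≤ p) :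
    LpNormT p (fun x => Kop h l (fun y => v y * g y) x - v x * Kop h l g x) ≤
      V * ENNReal.ofReal l * ((∫⁻ y : ℝ, ‖(y : ℂ) * h y‖ₑ) * LpNormT p g) := by
  have hlip := lipschitzWith_of_nnnorm_deriv_le hv.diff hV
  have hy := young (Complex.continuous_ofReal.mul hk.cont) hk.int1 hg hp l
  refine le_trans ?_ (mul_le_mul_right hy _)
  have := eLpNorm_le_nnreal_smul_eLpNorm_of_ae_le_mul'
    (f := fun x => Kop h l (fun y => v y * g y) x - v x * Kop h l g x)
    (g := fun x => ∫⁻ y : ℝ, ‖(y : ℂ) * h y‖ₑ * ‖g (x - l * y)‖ₑ) (μ := muT) (c := V * l.toNNReal)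
    (Eventually.of_forall ?_) p
  · refine this.trans (le_of_eq ?_)
    rw [ENNReal.smul_def, smul_eq_mul, ENNReal.coe_mul]
    rfl
  · intro x
    rw [enorm_eq_self, ENNReal.coe_mul]
    unfold Kop
    rw [← integral_const_mul, ← integral_sub (Kop_int hk l (hv.mul hg) x)
      ((Kop_int hk l hg x).const_mul _)]
    refine (enorm_integral_le_lintegral_enorm _).trans ?_
    rw [← lintegral_const_mul']
    · refine lintegral_mono fun y => ?_
      have e : h y * (v (x - l * y) * g (x - l * y)) - v x * (h y * g (x - l * y)) =
        (v (x - l * y) - v x) * (h y * g (x - l * y)) := by ring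
      simp only [e, enorm_mul]
      have h1 : ‖v (x - l * y) - v x‖ₑ ≤ V * (ENNReal.ofReal l * ‖(y : ℂ)‖ₑ) := by
        have := hlip (x - l * y) x
        rw [edist_eq_enorm_sub, edist_eq_enorm_sub] at this
        refine this.trans (le_of_eq ?_)
        congr 1
        rw [sub_sub_cancel_left, enorm_neg, enorm_mul, Real.enorm_eq_ofReal hl]
        congr 1
        simp [enorm]
      calc _ ≤ V * (ENNReal.ofReal l * ‖(y : ℂ)‖ₑ) * (‖h y‖ₑ * ‖g (x - l * y)‖ₑ) := by gcongr
        _ = _ := by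
          rw [ENNReal.ofReal]; ring
    · exact ENNReal.mul_ne_top ENNReal.coe_ne_top ENNReal.coe_ne_top

lemma Kop_approx {h m : ℝ → ℂ} (hk : IsKer h m) (hm : m 0 = 1) {u : ℝ → ℂ} (hu : SP u) :
    ∃ B : ℝ, 0 ≤ B ∧ ∀ l : ℝ, 0 ≤ l → ∀ x, ‖Kop h l u x - u x‖ ≤ l * B := by
  obtain ⟨V, hV⟩ := hu.deriv.bdd
  have hV0 : 0 ≤ V := (norm_nonneg _).trans (hV 0)
  have hlip := lipschitzWith_of_nnnorm_deriv_le (C := V.toNNReal) hu.diff (fun x => by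
    rw [← NNReal.coe_le_coe, coe_nnnorm, Real.coe_toNNReal _ hV0]; exact hV x)
  refine ⟨V * ∫ y : ℝ, ‖(y : ℂ) * h y‖, by positivity, fun l hl x => ?_⟩
  have h1 : u x = ∫ y, h y * u x := by
    rw [integral_mul_const]
    have := hk.ft 0
    simp only [Complex.ofReal_zero, mul_zero, Complex.exp_zero, mul_one] at this
    rw [this, hm, one_mul]
  conv_lhs => rw [h1]
  unfold Kop
  rw [← integral_sub (Kop_int hk l hu x) (hk.int.mul_const _), ← mul_assoc, ← integral_const_mul]
  refine norm_integral_le_of_norm_le (hk.int1.norm.const_mul _) (Eventually.of_forall fun y => ?_)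
  have h2 := hlip.dist_le_mul (x - l * y) x
  rw [dist_eq_norm, dist_eq_norm, Real.coe_toNNReal _ hV0, sub_sub_cancel_left, norm_neg, norm_mul,
    Real.norm_of_nonneg hl] at h2
  rw [← mul_sub, norm_mul, norm_mul, Complex.norm_real]
  calc _ ≤ ‖h y‖ * (V * (l * ‖y‖)) := by gcongr
    _ = _ := by ring

lemma Kop_sub {h m : ℝ → ℂ} (hk : IsKer h m) (l : ℝ) {u w : ℝ → ℂ} (hu : SP u) (hw : SP w) (x : ℝ) :
    Kop h l (fun y => u y - w y) x = Kop h l u x - Kop h l w x := by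
  unfold Kop
  rw [← integral_sub (Kop_int hk l hu x) (Kop_int hk l hw x)]
  congr 1; ext y; ring

lemma Kop_add {h m : ℝ → ℂ} (hk : IsKer h m) (l : ℝ) {u w : ℝ → ℂ} (hu : SP u) (hw : SP w) (x : ℝ) :
    Kop h l (fun y => u y + w y) x = Kop h l u x + Kop h l w x := by
  unfold Kop
  rw [← integral_add (Kop_int hk l hu x) (Kop_int hk l hw x)]
  congr 1; ext y; ring

lemma Kop_trig {h m : ℝ → ℂ} (hk : IsKer h m) (l : ℝ) {ι : Type*} (s : Finset ι) (n : ι → ℤ)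
    (a : ι → ℂ) (x : ℝ) :
    Kop h l (fun y => ∑ i ∈ s, a i * ex (n i) y) x = ∑ i ∈ s, m (l * n i) * (a i * ex (n i) x) := by
  have : ∀ i, m (l * n i) * (a i * ex (n i) x) = ∫ y, h y * (a i * ex (n i) (x - l * y)) := by
    intro i
    have := Kop_ex hk l (n i) x
    rw [mul_left_comm, ← this, Kop, ← integral_const_mul]
    congr 1; ext y; ring
  simp only [this]
  rw [← integral_finsetSum]
  · unfold Kop
    congr 1; ext y
    rw [Finset.mul_sum]
  · intro i _
    exact Kop_int hk l ((SP.const (a i)).mul (ex_SP (n i))) x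

def lam (n : ℕ) : ℝ := 2 * (1 / 2) ^ n

lemma lam_pos (n : ℕ) : 0 < lam n := by unfold lam; positivity

lemma lam_succ (n : ℕ) : lam (n + 1) = lam n / 2 := by unfold lam; rw [pow_succ]; ring

def mB (c : LPCutoff) (n : ℕ) (x : ℝ) : ℂ := if n = 0 then (c.χ (x / 2) : ℂ) else (c.phi x : ℂ)

def mP (c : LPCutoff) (n : ℕ) (x : ℝ) : ℂ := if n = 0 then 0 else (c.χ x : ℂ)

def Tr (a : ℤ → ℂ) (u : ℝ → ℂ) (x : ℝ) : ℂ :=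
  (1 / (2 * Real.pi) : ℂ) * ∑' ξ : ℤ, a ξ * fCoeff u ξ * ex ξ x

def DD (c : LPCutoff) (n : ℕ) (u : ℝ → ℂ) : ℝ → ℂ := Tr (fun ξ => mB c n (lam n * ξ)) u

def PP (c : LPCutoff) (n : ℕ) (u : ℝ → ℂ) : ℝ → ℂ := Tr (fun ξ => mP c n (lam n * ξ)) u

lemma block_eq (c : LPCutoff) (n : ℕ) (u : ℝ → ℂ) : LPblock c ((n : ℤ) - 1) u = DD c n u := by
  ext x
  unfold LPblock DD Tr mB
  rcases n with _ | n
  · simp only [Nat.cast_zero, zero_sub, if_true, lam, pow_zero, mul_one, ex]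
    congr 2
    ext ξ
    congr 4
    ring
  · have h1 : ¬ (((n + 1 : ℕ) : ℤ) - 1 = -1) := by push_cast; omega
    simp only [h1, if_false, Nat.succ_ne_zero, ex]
    have h2 : (2 : ℝ) ^ (-(((n + 1 : ℕ) : ℤ) - 1)) = lam (n + 1) := by
      have : (((n + 1 : ℕ) : ℤ) - 1) = (n : ℤ) := by push_cast; ring
      rw [this, lam, pow_succ, zpow_neg, zpow_natCast]
      simp
      ring
    rw [h2]

lemma phi_zero (c : LPCutoff) {x : ℝ} (hx : |x| ≤ 3 / 4) : c.phi x = 0 := by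
  rw [abs_le] at hx
  unfold LPCutoff.phi
  rw [c.eq_one x ⟨by linarith, hx.2⟩, c.eq_one (x / 2) ⟨by linarith, by linarith⟩, sub_self]

lemma chi_supp (c : LPCutoff) {x : ℝ} (hx : 4 / 3 ≤ |x|) : c.χ x = 0 := by
  by_contra h
  have := c.supp x h
  rw [Set.mem_Ioo, ← abs_lt] at this
  linarith

lemma phi_supp (c : LPCutoff) {x : ℝ} (hx : 8 / 3 ≤ |x|) : c.phi x = 0 := by
  unfold LPCutoff.phi
  rw [chi_supp c (x := x) (by linarith), chi_supp c (x := x / 2), sub_self]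
  rw [abs_div, abs_two]
  linarith

lemma mB_supp (c : LPCutoff) (n : ℕ) {x : ℝ} (hx : 8 / 3 ≤ |x|) : mB c n x = 0 := by
  unfold mB
  split_ifs
  · rw [chi_supp c (x := x / 2)]; · simp
    rw [abs_div, abs_two]
    linarith
  · rw [phi_supp c hx]; simp

lemma mP_supp (c : LPCutoff) (n : ℕ) {x : ℝ} (hx : 4 / 3 ≤ |x|) : mP c n x = 0 := by
  unfold mP
  split_ifs
  · rfl
  · rw [chi_supp c hx]; simp

lemma hcs_of {m : ℝ → ℂ} {R : ℝ} (hm : ∀ x, R ≤ |x| → m x = 0) : HasCompactSupport m := by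
  refine HasCompactSupport.of_support_subset_isCompact (isCompact_Icc (a := -R) (b := R)) ?_
  intro x hx
  rw [Set.mem_Icc, ← abs_le]
  by_contra h
  exact hx (hm x (by linarith))

lemma fin_supp {m : ℝ → ℂ} {R : ℝ} (hm : ∀ x, R ≤ |x| → m x = 0) (l : ℝ) (hl : 0 < l) :
    (Function.support fun ξ : ℤ => m (l * ξ)).Finite := by
  refine (Set.finite_Icc (-⌈R / l⌉) ⌈R / l⌉).subset ?_
  intro ξ hξ
  have h1 : |l * (ξ : ℝ)| < R := by
    by_contra h
    exact hξ (hm _ (by linarith))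
  rw [abs_mul, abs_of_pos hl, mul_comm, ← lt_div_iff₀ hl] at h1
  have h2 : |(ξ : ℝ)| ≤ (⌈R / l⌉ : ℝ) := h1.le.trans (Int.le_ceil _)
  rw [abs_le] at h2
  constructor
  · exact_mod_cast h2.1
  · exact_mod_cast h2.2

lemma mB_fin (c : LPCutoff) (n : ℕ) : (Function.support fun ξ : ℤ => mB c n (lam n * ξ)).Finite :=
  fin_supp (fun _ => mB_supp c n) _ (lam_pos n)

lemma mP_fin (c : LPCutoff) (n : ℕ) : (Function.support fun ξ : ℤ => mP c n (lam n * ξ)).Finite :=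
  fin_supp (fun _ => mP_supp c n) _ (lam_pos n)

lemma Tr_eq {a : ℤ → ℂ} (ha : (Function.support a).Finite) (u : ℝ → ℂ) :
    Tr a u = fun x => ∑ ξ ∈ ha.toFinset, ((1 / (2 * Real.pi) : ℂ) * (a ξ * fCoeff u ξ)) * ex ξ x := by
  ext x
  unfold Tr
  rw [tsum_eq_sum (s := ha.toFinset), Finset.mul_sum]
  · refine Finset.sum_congr rfl fun ξ _ => by ring
  · intro ξ hξ
    have : a ξ = 0 := by simpa using hξ
    rw [this]; simp

lemma Tr_SP {a : ℤ → ℂ} (ha : (Function.support a).Finite) (u : ℝ → ℂ) : SP (Tr a u) := by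
  rw [Tr_eq ha]
  exact SP.sum _ fun ξ _ => (SP.const _).mul (ex_SP ξ)

lemma Tr_add {a b : ℤ → ℂ} (ha : (Function.support a).Finite) (hb : (Function.support b).Finite)
    (u : ℝ → ℂ) (x : ℝ) : Tr (fun ξ => a ξ + b ξ) u x = Tr a u x + Tr b u x := by
  have hs : ∀ {a : ℤ → ℂ}, (Function.support a).Finite →
      Summable fun ξ => a ξ * fCoeff u ξ * ex ξ x := by
    intro a ha
    refine summable_of_ne_finset_zero (s := ha.toFinset) fun ξ hξ => ?_
    have : a ξ = 0 := by simpa using hξ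
    rw [this]; simp
  unfold Tr
  rw [← mul_add, ← (hs ha).tsum_add (hs hb)]
  congr 2
  ext ξ
  ring

lemma Tr_deriv {a : ℤ → ℂ} (ha : (Function.support a).Finite) {u : ℝ → ℂ} (hu : SP u) :
    deriv (Tr a u) = Tr a (deriv u) := by
  ext x
  rw [Tr_eq ha, Tr_eq ha]
  have : HasDerivAt (fun x => ∑ ξ ∈ ha.toFinset, ((1 / (2 * Real.pi) : ℂ) * (a ξ * fCoeff u ξ)) * ex ξ x)
      (∑ ξ ∈ ha.toFinset, ((1 / (2 * Real.pi) : ℂ) * (a ξ * fCoeff u ξ)) *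
        (Complex.I * ξ * ex ξ x)) x :=
    HasDerivAt.fun_sum fun ξ _ => (ex_hasDerivAt ξ x).const_mul _
  rw [this.deriv]
  refine Finset.sum_congr rfl fun ξ _ => ?_
  rw [fCoeff_deriv hu]
  ring

lemma DD_SP (c : LPCutoff) (n : ℕ) (u : ℝ → ℂ) : SP (DD c n u) := Tr_SP (mB_fin c n) u

lemma PP_SP (c : LPCutoff) (n : ℕ) (u : ℝ → ℂ) : SP (PP c n u) := Tr_SP (mP_fin c n) u

lemma PP_zero (c : LPCutoff) (u : ℝ → ℂ) : PP c 0 u = fun _ => 0 := by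
  ext x
  simp [PP, Tr, mP]

lemma PP_succ (c : LPCutoff) (n : ℕ) (u : ℝ → ℂ) (x : ℝ) :
    PP c (n + 1) u x = PP c n u x + DD c n u x := by
  unfold PP DD
  rw [← Tr_add (mP_fin c n) (mB_fin c n)]
  congr 1
  ext ξ
  unfold mP mB
  rcases n with _ | n
  · simp only [Nat.succ_ne_zero, if_true, if_false, lam_succ]
    rw [zero_add]
    congr 2
    ring
  · simp only [Nat.succ_ne_zero, if_false, LPCutoff.phi]
    rw [lam_succ (n + 1)]
    push_cast
    rw [add_sub_cancel]
    congr 2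
    ring

lemma PP_sum (c : LPCutoff) (N M : ℕ) (u : ℝ → ℂ) (x : ℝ) :
    PP c (N + M) u x = PP c N u x + ∑ i ∈ Finset.range M, DD c (N + i) u x := by
  induction M with
  | zero => simp
  | succ M ih => rw [← add_assoc, PP_succ, ih, Finset.sum_range_succ, add_assoc]

lemma phi_smooth (c : LPCutoff) : ContDiff ℝ (⊤ : ℕ∞) c.phi := by
  unfold LPCutoff.phi
  have := c.smooth
  exact (c.smooth.comp (contDiff_id.div_const 2)).sub c.smooth

lemma mB_smooth (c : LPCutoff) (n : ℕ) : ContDiff ℝ (⊤ : ℕ∞) (mB c n) := by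
  unfold mB
  split_ifs
  · exact Complex.ofRealCLM.contDiff.comp (c.smooth.comp (contDiff_id.div_const 2))
  · exact Complex.ofRealCLM.contDiff.comp (phi_smooth c)

lemma exists_ker {m : ℝ → ℂ} {R : ℝ} (hs : ContDiff ℝ (⊤ : ℕ∞) m) (hm : ∀ x, R ≤ |x| → m x = 0) :
    ∃ h, IsKer h m := by
  obtain ⟨h, h1, h2, h3, h4⟩ := exists_kernel m hs (hcs_of hm)
  exact ⟨h, h1, h2, h3, h4⟩

lemma DD_Kop (c : LPCutoff) {n : ℕ} {h : ℝ → ℂ} (hk : IsKer h (mB c n)) {u : ℝ → ℂ} (hu : SP u)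
    (x : ℝ) : DD c n u x = Kop h (lam n) u x := by
  rw [Kop_fourier hk _ hu]
  unfold DD Tr
  congr 2

lemma DD_deriv_Kop (c : LPCutoff) {n : ℕ} {h : ℝ → ℂ}
    (hk : IsKer h (fun x => Complex.I * x * mB c n x)) {u : ℝ → ℂ} (hu : SP u) (x : ℝ) :
    DD c n (deriv u) x = (1 / lam n : ℂ) * Kop h (lam n) u x := by
  rw [Kop_fourier hk _ hu]
  unfold DD Tr
  rw [mul_left_comm, ← tsum_mul_left (a := (1 / lam n : ℂ))]
  refine congrArg _ ?_
  refine tsum_congr fun ξ => ?_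
  rw [fCoeff_deriv hu]
  have : (lam n : ℂ) ≠ 0 := by exact_mod_cast (lam_pos n).ne'
  push_cast
  field_simp

lemma PP_Kop (c : LPCutoff) {n : ℕ} (hn : n ≠ 0) {h : ℝ → ℂ} (hk : IsKer h (fun x => (c.χ x : ℂ)))
    {u : ℝ → ℂ} (hu : SP u) (x : ℝ) : PP c n u x = Kop h (lam n) u x := by
  rw [Kop_fourier hk _ hu]
  unfold PP Tr mP
  simp only [hn, if_false]

lemma chi_ker (c : LPCutoff) : ∃ h, IsKer h (fun x => (c.χ x : ℂ)) :=
  exists_ker (R := 4 / 3) (Complex.ofRealCLM.contDiff.comp c.smooth)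
    (fun x hx => by simp [chi_supp c hx])

def bm (c : LPCutoff) (x : ℝ) : ℂ := ((c.χ (x / 4) - c.χ (4 * x) : ℝ) : ℂ) / (Complex.I * x)

lemma bm_ker (c : LPCutoff) : ∃ h, IsKer h (bm c) := by
  refine exists_ker (R := 16 / 3) ?_ ?_
  · rw [contDiff_iff_contDiffAt]
    intro x
    by_cases hx : x = 0
    · subst hx
      have : bm c =ᶠ[nhds 0] fun _ => 0 := by
        have h1 : Set.Ioo (-(1/8) : ℝ) (1/8) ∈ nhds (0:ℝ) := Ioo_mem_nhds (by norm_num) (by norm_num)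
        filter_upwards [h1] with y hy
        unfold bm
        rw [c.eq_one (y / 4) ⟨by linarith [hy.1], by linarith [hy.2]⟩,
          c.eq_one (4 * y) ⟨by linarith [hy.1], by linarith [hy.2]⟩]
        simp
      exact contDiffAt_const.congr_of_eventuallyEq this
    · unfold bm
      have h1 : ContDiffAt ℝ (⊤ : ℕ∞) (fun x : ℝ => ((c.χ (x / 4) - c.χ (4 * x) : ℝ) : ℂ)) x :=
        (Complex.ofRealCLM.contDiff.comp ((c.smooth.comp (contDiff_id.div_const 4)).sub
          (c.smooth.comp (contDiff_const.mul contDiff_id)))).contDiffAt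
      have h2 : ContDiffAt ℝ (⊤ : ℕ∞) (fun x : ℝ => Complex.I * (x : ℂ)) x :=
        (contDiff_const.mul Complex.ofRealCLM.contDiff).contDiffAt
      simp only [div_eq_mul_inv]
      simp only [div_eq_mul_inv] at h1
      exact h1.mul (h2.inv (mul_ne_zero Complex.I_ne_zero (by exact_mod_cast hx)))
  · intro x hx
    unfold bm
    rw [chi_supp c (x := x / 4), chi_supp c (x := 4 * x)]
    · simp
    · rw [abs_mul, abs_of_pos (by norm_num : (0:ℝ) < 4)]; linarith
    · rw [abs_div, abs_of_pos (by norm_num : (0:ℝ) < 4)]; linarith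

lemma bm_phi (c : LPCutoff) (x : ℝ) : bm c x * (Complex.I * x) * c.phi x = c.phi x := by
  by_cases h : c.phi x = 0
  · simp [h]
  have h1 : 3 / 4 < |x| := by
    by_contra h'
    exact h (phi_zero c (by linarith))
  have h2 : |x| < 8 / 3 := by
    by_contra h'
    exact h (phi_supp c (by linarith))
  have hx : x ≠ 0 := by
    rintro rfl
    simp at h1
    linarith
  unfold bm
  rw [chi_supp c (x := 4 * x), c.eq_one (x / 4)]
  · have : (x : ℂ) ≠ 0 := by exact_mod_cast hx
    have := Complex.I_ne_zero
    rw [div_mul_cancel₀]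
    · simp
    · exact mul_ne_zero Complex.I_ne_zero (by exact_mod_cast hx)
  · rw [abs_lt] at h2
    exact ⟨by linarith, by linarith⟩
  · rw [abs_mul, abs_of_pos (by norm_num : (0:ℝ) < 4)]; linarith

lemma DD_bern (c : LPCutoff) {n : ℕ} (hn : n ≠ 0) {h : ℝ → ℂ} (hk : IsKer h (bm c)) {u : ℝ → ℂ}
    (hu : SP u) (x : ℝ) :
    DD c n u x = (lam n : ℂ) * Kop h (lam n) (DD c n (deriv u)) x := by
  unfold DD
  rw [Tr_eq (mB_fin c n), Tr_eq (mB_fin c n), Kop_trig hk, Finset.mul_sum]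
  refine Finset.sum_congr rfl fun ξ _ => ?_
  rw [fCoeff_deriv hu]
  have := bm_phi c (lam n * ξ)
  simp only [mB, hn, if_false]
  nth_rewrite 1 [← this]
  push_cast
  ring

lemma vanish1 (c : LPCutoff) (N : ℕ) (w : ℝ → ℂ) (x : ℝ) : DD c (N + 3) (PP c (N + 1) w) x = 0 := by
  obtain ⟨h, hk⟩ := exists_ker (mB_smooth c (N + 3)) (fun x => mB_supp c (N + 3))
  rw [DD_Kop c hk (PP_SP c _ w)]
  unfold PP
  rw [Tr_eq (mP_fin c _), Kop_trig hk]
  refine Finset.sum_eq_zero fun ξ _ => ?_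
  by_cases h1 : |lam (N + 1) * ξ| < 4 / 3
  · have : mB c (N + 3) (lam (N + 3) * ξ) = 0 := by
      simp only [mB, Nat.succ_ne_zero, if_false]
      rw [phi_zero]
      · simp
      · rw [lam_succ (N + 2), lam_succ (N + 1)]
        rw [abs_lt] at h1
        rw [abs_le]
        constructor <;> linarith
    rw [this, zero_mul]
  · rw [mP_supp c _ (by linarith)]
    simp

lemma vanish2 (c : LPCutoff) (N : ℕ) (v w : ℝ → ℂ) (x : ℝ) :
    DD c (N + 3) (fun y => PP c (N + 1) v y * PP c (N + 1) w y) x = 0 := by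
  obtain ⟨h, hk⟩ := exists_ker (mB_smooth c (N + 3)) (fun x => mB_supp c (N + 3))
  rw [DD_Kop c hk ((PP_SP c _ v).mul (PP_SP c _ w))]
  unfold PP
  rw [Tr_eq (mP_fin c _), Tr_eq (mP_fin c _)]
  simp only [Finset.sum_mul_sum, ← Finset.sum_product']
  set S := (mP_fin c (N + 1)).toFinset
  have := Kop_trig hk (lam (N + 3)) (S ×ˢ S) (fun i => i.1 + i.2)
    (fun i => ((1 / (2 * Real.pi) : ℂ) * (mP c (N + 1) (lam (N + 1) * i.1) * fCoeff v i.1)) *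
      ((1 / (2 * Real.pi) : ℂ) * (mP c (N + 1) (lam (N + 1) * i.2) * fCoeff w i.2))) x
  simp only [← ex_mul] at this
  simp only [mul_mul_mul_comm _ (ex _ _)]
  rw [this]
  refine Finset.sum_eq_zero fun i _ => ?_
  by_cases h1 : |lam (N + 1) * i.1| < 4 / 3
  · by_cases h2 : |lam (N + 1) * i.2| < 4 / 3
    · have : mB c (N + 3) (lam (N + 3) * ((i.1 + i.2 : ℤ) : ℝ)) = 0 := by
        simp only [mB, Nat.succ_ne_zero, if_false]
        rw [phi_zero]
        · simp
        · rw [lam_succ (N + 2), lam_succ (N + 1)]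
          rw [abs_lt] at h1 h2
          push_cast
          rw [abs_le]
          constructor <;> linarith
      rw [this, zero_mul]
    · rw [mP_supp c _ (x := lam (N + 1) * i.2) (by linarith)]
      simp
  · rw [mP_supp c _ (x := lam (N + 1) * i.1) (by linarith)]
    simp

lemma tail (c : LPCutoff) {u : ℝ → ℂ} (hu : SP u) {p : ℝ≥0∞} (hp : 1 ≤ p) (N : ℕ) :
    LpNormT p (fun x => u x - PP c N u x) ≤ ∑' i, LpNormT p (DD c (N + i) u) := by
  obtain ⟨h, hk⟩ := chi_ker c
  obtain ⟨B, hB, hap⟩ := Kop_approx hk (by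
    rw [c.eq_one 0 ⟨by norm_num, by norm_num⟩]; simp) hu
  have hb : ∀ M : ℕ, LpNormT p (fun x => u x - PP c N u x) ≤
      (muT Set.univ) ^ p.toReal⁻¹ * ENNReal.ofReal (lam (N + (M + 1)) * B) +
        ∑' i, LpNormT p (DD c (N + i) u) := by
    intro M
    have e : (fun x => u x - PP c N u x) = (fun x => u x - PP c (N + (M + 1)) u x) +
        ∑ i ∈ Finset.range (M + 1), DD c (N + i) u := by
      ext x
      simp only [Pi.add_apply, Finset.sum_apply]
      rw [PP_sum c N (M + 1)]
      ring
    rw [e]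
    refine (eLpNorm_add_le ((hu.sub (PP_SP c _ u)).aesm _) ?_ hp).trans ?_
    · have : SP (∑ i ∈ Finset.range (M + 1), DD c (N + i) u) := by
        have := SP.sum (Finset.range (M + 1)) (u := fun i => DD c (N + i) u)
          (fun i _ => DD_SP c (N + i) u)
        convert this
        simp
      exact this.aesm _
    · refine add_le_add (eLpNorm_le_of_ae_bound (Eventually.of_forall fun x => ?_)) ?_
      · rw [PP_Kop c (by omega) hk hu, norm_sub_rev]
        exact hap _ (lam_pos _).le x
      · refine (eLpNorm_sum_le (fun i _ => (DD_SP c (N + i) u).aesm _) hp).trans ?_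
        exact ENNReal.sum_le_tsum _
  have hlim : Tendsto (fun M : ℕ => (muT Set.univ) ^ p.toReal⁻¹ *
      ENNReal.ofReal (lam (N + (M + 1)) * B) + ∑' i, LpNormT p (DD c (N + i) u)) atTop
      (nhds (0 + ∑' i, LpNormT p (DD c (N + i) u))) := by
    refine Tendsto.add ?_ tendsto_const_nhds
    have h1 : Tendsto (fun M : ℕ => lam (N + (M + 1)) * B) atTop (nhds 0) := by
      have : Tendsto (fun M : ℕ => (1 / 2 : ℝ) ^ M) atTop (nhds 0) :=
        tendsto_pow_atTop_nhds_zero_of_lt_one (by norm_num) (by norm_num)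
      have h2 := this.const_mul (lam N / 2 * B)
      rw [mul_zero] at h2
      refine h2.congr fun M => ?_
      unfold lam
      rw [pow_add, pow_succ]
      ring
    have h2 := ENNReal.tendsto_ofReal h1
    rw [ENNReal.ofReal_zero] at h2
    have h3 := ENNReal.Tendsto.const_mul (a := (muT Set.univ) ^ p.toReal⁻¹) h2 (Or.inr
      (ENNReal.rpow_ne_top_of_nonneg (by positivity) (measure_ne_top _ _)))
    rwa [mul_zero] at h3
  rw [zero_add] at hlim
  exact ge_of_tendsto' hlim hb

lemma lr_eq {r : ℝ≥0∞} (hr : 1 ≤ r) (a : ℕ → ℝ≥0∞) : lrNormE r a = eLpNorm a r Measure.count := by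
  unfold lrNormE
  split_ifs with h
  · subst h
    rw [eLpNorm_exponent_top, eLpNormEssSup]
    simp
  · rw [eLpNorm_eq_lintegral_rpow_enorm_toReal (by positivity) h, lintegral_count]
    simp

lemma lr_mono {r : ℝ≥0∞} (hr : 1 ≤ r) {a b : ℕ → ℝ≥0∞} (h : ∀ k, a k ≤ b k) :
    lrNormE r a ≤ lrNormE r b := by
  rw [lr_eq hr, lr_eq hr]
  exact eLpNorm_mono_enorm fun x => by simpa using h x

lemma lr_add {r : ℝ≥0∞} (hr : 1 ≤ r) (a b : ℕ → ℝ≥0∞) :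
    lrNormE r (fun k => a k + b k) ≤ lrNormE r a + lrNormE r b := by
  rw [lr_eq hr, lr_eq hr, lr_eq hr]
  exact eLpNorm_add_le (by measurability) (by measurability) hr

lemma lr_smul {r : ℝ≥0∞} (hr : 1 ≤ r) (K : ℝ≥0∞) (a : ℕ → ℝ≥0∞) :
    lrNormE r (fun k => K * a k) = K * lrNormE r a := by
  unfold lrNormE
  split_ifs with h
  · rw [ENNReal.mul_iSup]
  · have h0 : 0 < r.toReal := ENNReal.toReal_pos (by positivity) h
    simp_rw [ENNReal.mul_rpow_of_nonneg _ _ h0.le]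
    rw [ENNReal.tsum_mul_left, ENNReal.mul_rpow_of_nonneg _ _ (by positivity), ← ENNReal.rpow_mul,
      mul_one_div_cancel h0.ne', ENNReal.rpow_one]

lemma lr_shift {r : ℝ≥0∞} (hr : 1 ≤ r) (a : ℕ → ℝ≥0∞) (i : ℕ) :
    lrNormE r (fun k => a (k - 2 + i)) ≤ 3 * lrNormE r a := by
  unfold lrNormE
  split_ifs with h
  · refine (iSup_le fun k => le_iSup a (k - 2 + i)).trans ?_
    exact le_mul_of_one_le_left (by positivity) (by norm_num)
  · have h1 : 1 ≤ r.toReal := by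
      simpa using (ENNReal.toReal_le_toReal (by simp) h).2 hr
    have h0 : 0 < r.toReal := by linarith
    set b : ℕ → ℝ≥0∞ := fun k => a k ^ r.toReal with hb
    have h2 : ∑' k, b (k - 2 + i) ≤ 3 * ∑' k, b k := by
      rw [← (ENNReal.summable (f := fun k => b (k + 2 - 2 + i))).sum_add_tsum_nat_add' (f := fun k => b (k - 2 + i))]
      have e1 : ∀ k, b k ≤ ∑' k, b k := ENNReal.le_tsum
      have e2 : ∑' k, b (k + 2 - 2 + i) ≤ ∑' k, b k := by
        simp only [Nat.add_sub_cancel]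
        exact ENNReal.tsum_comp_le_tsum_of_injective (add_left_injective i) b
      have e3 : ∑ k ∈ Finset.range 2, b (k - 2 + i) ≤ 2 * ∑' k, b k := by
        rw [Finset.sum_range_succ, Finset.sum_range_one, two_mul]
        exact add_le_add (e1 _) (e1 _)
      calc _ ≤ 2 * ∑' k, b k + ∑' k, b k := add_le_add e3 e2
        _ = _ := by ring
    calc _ ≤ (3 * ∑' k, b k) ^ (1 / r.toReal) := ENNReal.rpow_le_rpow h2 (by positivity)
      _ = 3 ^ (1 / r.toReal) * (∑' k, b k) ^ (1 / r.toReal) :=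
        ENNReal.mul_rpow_of_nonneg _ _ (by positivity)
      _ ≤ _ := by
        gcongr
        calc (3 : ℝ≥0∞) ^ (1 / r.toReal) ≤ 3 ^ (1 : ℝ) :=
              ENNReal.rpow_le_rpow_of_exponent_le (by norm_num) (by
                rw [div_le_one h0]; exact h1)
          _ = 3 := ENNReal.rpow_one _

lemma lr_conv {r : ℝ≥0∞} (hr : 1 ≤ r) (a : ℕ → ℝ≥0∞) :
    lrNormE r (fun k => ∑' i, (2⁻¹ : ℝ≥0∞) ^ i * a (k - 2 + i)) ≤ 6 * lrNormE r a := by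
  have hm : ∑' i : ℕ, (2⁻¹ : ℝ≥0∞) ^ i = 2 := by
    rw [ENNReal.tsum_geometric, ENNReal.one_sub_inv_two, inv_inv]
  have hl : ∀ F : ℕ → ℝ≥0∞, ∫⁻ y, F y ∂(Measure.count.withDensity fun i : ℕ => (2⁻¹ : ℝ≥0∞) ^ i) =
      ∑' i, (2⁻¹ : ℝ≥0∞) ^ i * F i := by
    intro F
    rw [lintegral_withDensity_eq_lintegral_mul _ (by measurability) (by measurability), lintegral_count]
    rfl
  have : IsFiniteMeasure (Measure.count.withDensity fun i : ℕ => (2⁻¹ : ℝ≥0∞) ^ i) := by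
    apply isFiniteMeasure_withDensity
    rw [lintegral_count, hm]
    simp
  have h := mink (μ := (Measure.count : Measure ℕ))
    (ν := Measure.count.withDensity fun i : ℕ => (2⁻¹ : ℝ≥0∞) ^ i) hr
    (fun k i => a (k - 2 + i)) (by measurability) (3 * lrNormE r a) (fun i => by
      rw [← lr_eq hr]; exact lr_shift hr a i)
  simp_rw [hl] at h
  rw [← lr_eq hr] at h
  refine h.trans (le_of_eq ?_)
  rw [withDensity_apply _ MeasurableSet.univ, Measure.restrict_univ, lintegral_count, hm, ← mul_assoc]
  norm_num

def wt (k : ℕ) : ℝ≥0∞ := ENNReal.ofReal (2 ^ k / 2)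

lemma wt_eq (k : ℕ) : (2 : ℝ≥0∞) ^ ((k : ℤ) - 1) = wt k := by
  unfold wt
  rw [ENNReal.zpow_sub (by simp) (by simp), zpow_natCast, zpow_one, ENNReal.ofReal_div_of_pos (by simp),
    ENNReal.ofReal_pow (by simp)]
  simp [div_eq_mul_inv]

lemma wt_eq2 (k : ℕ) : ENNReal.ofReal ((2 : ℝ) ^ (((k : ℝ) - 1) * 1)) = wt k := by
  unfold wt
  rw [mul_one, Real.rpow_sub (by simp), Real.rpow_natCast, Real.rpow_one]

lemma q_eq (i : ℕ) : (2⁻¹ : ℝ≥0∞) ^ i = ENNReal.ofReal ((1 / 2) ^ i) := by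
  rw [ENNReal.ofReal_pow (by norm_num), one_div, ENNReal.ofReal_inv_of_pos (by norm_num)]
  simp

lemma wt_real (k i : ℕ) : (2 : ℝ) ^ k / 2 * lam (k - 2 + i) ≤ 4 * (1 / 2) ^ i := by
  unfold lam
  have h : (2 : ℝ) ^ k * (1 / 2) ^ (k - 2) ≤ 4 := by
    rcases k with _ | _ | k
    · norm_num
    · norm_num
    · have : (2 : ℝ) ^ k * (1 / 2) ^ k = 1 := by rw [← mul_pow]; norm_num
      simp only [pow_succ] at *
      rw [show k + 1 + 1 - 2 = k by omega]
      nlinarith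
  have h2 : (0 : ℝ) ≤ (1 / 2) ^ i := by positivity
  rw [pow_add]
  calc _ = ((2 : ℝ) ^ k * (1 / 2) ^ (k - 2)) * (1 / 2) ^ i := by ring
    _ ≤ _ := mul_le_mul_of_nonneg_right h h2

lemma wt_lam (k i : ℕ) : wt k * ENNReal.ofReal (lam (k - 2 + i)) ≤ 4 * (2⁻¹ : ℝ≥0∞) ^ i := by
  rw [q_eq, wt, ← ENNReal.ofReal_mul (by positivity), show (4 : ℝ≥0∞) = ENNReal.ofReal 4 by simp,
    ← ENNReal.ofReal_mul (by positivity)]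
  exact ENNReal.ofReal_le_ofReal (wt_real k i)

lemma lam_wt (n : ℕ) : ENNReal.ofReal (lam n) * wt n = 1 := by
  rw [wt, ← ENNReal.ofReal_mul (lam_pos n).le, lam]
  have : (2 : ℝ) ^ n * (1 / 2) ^ n = 1 := by rw [← mul_pow]; norm_num
  rw [show 2 * (1 / 2) ^ n * ((2 : ℝ) ^ n / 2) = 2 ^ n * (1 / 2) ^ n by ring, this, ENNReal.ofReal_one]

lemma wt_wt (k i : ℕ) : wt k ≤ 4 * (2⁻¹ : ℝ≥0∞) ^ i * wt (k - 2 + i) := by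
  calc wt k = wt k * ENNReal.ofReal (lam (k - 2 + i)) * wt (k - 2 + i) := by
        rw [mul_assoc, lam_wt, mul_one]
    _ ≤ _ := mul_le_mul' (wt_lam k i) le_rfl

lemma unifH (c : LPCutoff) : ∃ K : ℝ≥0, ∀ n, ∃ h, IsKer h (mB c n) ∧ ∫⁻ y, ‖h y‖ₑ ≤ K := by
  obtain ⟨h0, k0⟩ := exists_ker (mB_smooth c 0) (fun x => mB_supp c 0)
  obtain ⟨h1, k1⟩ := exists_ker (mB_smooth c 1) (fun x => mB_supp c 1)
  refine ⟨(∫⁻ y, ‖h0 y‖ₑ).toNNReal + (∫⁻ y, ‖h1 y‖ₑ).toNNReal, fun n => ?_⟩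
  rw [ENNReal.coe_add, ENNReal.coe_toNNReal k0.int.2.ne, ENNReal.coe_toNNReal k1.int.2.ne]
  rcases n with _ | n
  · exact ⟨h0, k0, le_self_add⟩
  · refine ⟨h1, ?_, le_add_self⟩
    have : mB c (n + 1) = mB c 1 := by ext x; simp [mB]
    rw [this]; exact k1

lemma exG (c : LPCutoff) (n : ℕ) : ∃ h, IsKer h (fun x => Complex.I * x * mB c n x) := by
  refine exists_ker (R := 8 / 3) ?_ (fun x hx => by rw [mB_supp c n hx, mul_zero])
  exact (contDiff_const.mul Complex.ofRealCLM.contDiff).mul (mB_smooth c n)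

lemma unifG (c : LPCutoff) : ∃ K : ℝ≥0, ∀ n, ∃ h, IsKer h (fun x => Complex.I * x * mB c n x) ∧
    ∫⁻ y : ℝ, ‖(y : ℂ) * h y‖ₑ ≤ K := by
  obtain ⟨h0, k0⟩ := exG c 0
  obtain ⟨h1, k1⟩ := exG c 1
  refine ⟨(∫⁻ y : ℝ, ‖(y : ℂ) * h0 y‖ₑ).toNNReal + (∫⁻ y : ℝ, ‖(y : ℂ) * h1 y‖ₑ).toNNReal, fun n => ?_⟩
  rw [ENNReal.coe_add, ENNReal.coe_toNNReal k0.int1.2.ne, ENNReal.coe_toNNReal k1.int1.2.ne]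
  rcases n with _ | n
  · exact ⟨h0, k0, le_self_add⟩
  · refine ⟨h1, ?_, le_add_self⟩
    have : mB c (n + 1) = mB c 1 := by ext x; simp [mB]
    rw [this]; exact k1

lemma DD_sub (c : LPCutoff) (n : ℕ) {u w : ℝ → ℂ} (hu : SP u) (hw : SP w) (x : ℝ) :
    DD c n (fun y => u y - w y) x = DD c n u x - DD c n w x := by
  obtain ⟨h, hk⟩ := exists_ker (mB_smooth c n) (fun x => mB_supp c n)
  rw [DD_Kop c hk (hu.sub hw), DD_Kop c hk hu, DD_Kop c hk hw, Kop_sub hk _ hu hw]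

lemma LpNormT_cmul (p : ℝ≥0∞) (a : ℂ) (u : ℝ → ℂ) :
    LpNormT p (fun x => a * u x) = ‖a‖ₑ * LpNormT p u := by
  exact eLpNorm_const_smul a u p _

lemma LpNormT_sub {p : ℝ≥0∞} (hp : 1 ≤ p) {u w : ℝ → ℂ} (hu : Continuous u) (hw : Continuous w) :
    LpNormT p (fun x => u x - w x) ≤ LpNormT p u + LpNormT p w :=
  eLpNorm_sub_le hu.aestronglyMeasurable hw.aestronglyMeasurable hp

lemma LpNormT_add {p : ℝ≥0∞} (hp : 1 ≤ p) {u w : ℝ → ℂ} (hu : Continuous u) (hw : Continuous w) :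
    LpNormT p (fun x => u x + w x) ≤ LpNormT p u + LpNormT p w :=
  eLpNorm_add_le hu.aestronglyMeasurable hw.aestronglyMeasurable hp

lemma LpNormT_bmul (p : ℝ≥0∞) {b : ℝ → ℂ} {V : ℝ≥0} (hV : ∀ x, ‖b x‖₊ ≤ V) (u : ℝ → ℂ) :
    LpNormT p (fun x => b x * u x) ≤ V * LpNormT p u := by
  refine eLpNorm_le_nnreal_smul_eLpNorm_of_ae_le_mul (Eventually.of_forall fun x => ?_) p
  rw [nnnorm_mul]
  gcongr
  exact hV x

lemma high (c : LPCutoff) : ∃ K : ℝ≥0, ∀ (n : ℕ) (v g : ℝ → ℂ), SP v → SP g → ∀ V : ℝ≥0,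
    (∀ x, ‖deriv v x‖₊ ≤ V) → ∀ p : ℝ≥0∞, 1 ≤ p →
    LpNormT p (fun x => DD c n (fun y => v y * deriv g y) x - v x * DD c n (deriv g) x) ≤
      K * (V * LpNormT p g) := by
  obtain ⟨K1, h1⟩ := unifH c
  obtain ⟨K2, h2⟩ := unifG c
  refine ⟨K2 + K1, fun n v g hv hg V hV p hp => ?_⟩
  obtain ⟨H, kH, bH⟩ := h1 n
  obtain ⟨G, kG, bG⟩ := h2 n
  have hl := lam_pos n
  have hvg : SP (fun y => v y * g y) := hv.mul hg
  have hd : (fun y => v y * deriv g y) = fun y => deriv (fun y => v y * g y) y - deriv v y * g y := by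
    ext y
    have := ((hv.diff y).hasDerivAt.mul (hg.diff y).hasDerivAt).deriv
    have h' : deriv (fun y => v y * g y) y = deriv v y * g y + v y * deriv g y := this
    rw [h']; ring
  have hw : SP (fun y => deriv v y * g y) := hv.deriv.mul hg
  have key : (fun x => DD c n (fun y => v y * deriv g y) x - v x * DD c n (deriv g) x) =
      fun x => (1 / lam n : ℂ) * (Kop G (lam n) (fun y => v y * g y) x - v x * Kop G (lam n) g x)
        - DD c n (fun y => deriv v y * g y) x := by
    ext x
    rw [hd, DD_sub c n hvg.deriv hw, DD_deriv_Kop c kG hvg, DD_deriv_Kop c kG hg]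
    ring
  have hcont : ∀ u, SP u → Continuous (Kop G (lam n) u) := by
    intro u hu
    have : Kop G (lam n) u = fun x => (lam n : ℂ) * DD c n (deriv u) x := by
      ext x
      rw [DD_deriv_Kop c kG hu]
      have : (lam n : ℂ) ≠ 0 := by exact_mod_cast hl.ne'
      field_simp
    rw [this]
    exact continuous_const.mul (DD_SP c n _).cont
  rw [key]
  refine (LpNormT_sub hp (u := fun x => (1 / lam n : ℂ) * (Kop G (lam n) (fun y => v y * g y) x - v x * Kop G (lam n) g x))
    (continuous_const.mul ((hcont _ hvg).sub (hv.cont.mul (hcont _ hg))))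
    (DD_SP c n _).cont).trans ?_
  rw [LpNormT_cmul]
  have e1 := Kop_comm kG hl.le hv hg hV hp
  have e2 : LpNormT p (DD c n (fun y => deriv v y * g y)) ≤ K1 * (V * LpNormT p g) := by
    have : DD c n (fun y => deriv v y * g y) = Kop H (lam n) (fun y => deriv v y * g y) := by
      ext x; exact DD_Kop c kH hw x
    rw [this]
    refine (Kop_Lp kH _ hw hp).trans ?_
    gcongr
    exact LpNormT_bmul p hV g
  have e3 : ‖(1 / lam n : ℂ)‖ₑ * ENNReal.ofReal (lam n) = 1 := by
    have : ‖(1 / lam n : ℂ)‖ₑ = ENNReal.ofReal (1 / lam n) := by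
      rw [← ofReal_norm]
      congr 1
      rw [show (1 / lam n : ℂ) = ((1 / lam n : ℝ) : ℂ) by push_cast; rfl, Complex.norm_real,
        Real.norm_of_nonneg (by positivity)]
    rw [this, ← ENNReal.ofReal_mul (by positivity), one_div_mul_cancel hl.ne', ENNReal.ofReal_one]
  rw [ENNReal.coe_add, add_mul]
  refine add_le_add ?_ e2
  calc _ ≤ ‖(1 / lam n : ℂ)‖ₑ * (V * ENNReal.ofReal (lam n) * (K2 * LpNormT p g)) := by
        gcongr
        exact e1.trans (by gcongr)
    _ = ‖(1 / lam n : ℂ)‖ₑ * ENNReal.ofReal (lam n) * (K2 * (V * LpNormT p g)) := by ring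
    _ = _ := by rw [e3, one_mul]

lemma LpNormT_holder {p p₁ p₂ : ℝ≥0∞} (hH : ENNReal.HolderTriple p₁ p₂ p) {u w : ℝ → ℂ}
    (hu : Continuous u) (hw : Continuous w) :
    LpNormT p (fun y => u y * w y) ≤ LpNormT p₁ u * LpNormT p₂ w := by
  have h := eLpNorm_smul_le_mul_eLpNorm (p := p₁) (q := p₂) (r := p)
    (μ := volume.restrict (Set.Ioc (-Real.pi) Real.pi))
    (f := w) (φ := u) hw.aestronglyMeasurable hu.aestronglyMeasurable
  have e : u • w = fun y => u y * w y := by ext y; simp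
  rw [e] at h
  exact h

lemma low (c : LPCutoff) : ∃ K : ℝ≥0, ∀ (N : ℕ) (v f : ℝ → ℂ), SP v → SP f →
    ∀ p p₁ p₂ : ℝ≥0∞, 1 ≤ p → 1 ≤ p₁ → 1 ≤ p₂ → ENNReal.HolderTriple p₁ p₂ p →
    LpNormT p (fun x => DD c (N + 3) (fun y => v y * deriv (PP c (N + 1) f) y) x -
      v x * DD c (N + 3) (deriv (PP c (N + 1) f)) x) ≤
      K * (LpNormT p₂ (deriv f) *
        ∑' i, ENNReal.ofReal (lam (N + 1 + i)) * LpNormT p₁ (DD c (N + 1 + i) (deriv v))) := by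
  obtain ⟨K1, h1⟩ := unifH c
  obtain ⟨X, kX⟩ := chi_ker c
  obtain ⟨B, kB⟩ := bm_ker c
  refine ⟨K1 * (∫⁻ y, ‖X y‖ₑ).toNNReal * (∫⁻ y, ‖B y‖ₑ).toNNReal, ?_⟩
  intro N v f hv hf p p₁ p₂ hp hp₁ hp₂ hH
  obtain ⟨H, kH, bH⟩ := h1 (N + 3)
  rw [ENNReal.coe_mul, ENNReal.coe_mul, ENNReal.coe_toNNReal kX.int.2.ne,
    ENNReal.coe_toNNReal kB.int.2.ne]
  have hd : deriv (PP c (N + 1) f) = PP c (N + 1) (deriv f) := Tr_deriv (mP_fin c _) hf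
  rw [hd]
  set F := PP c (N + 1) (deriv f) with hF
  have sF : SP F := PP_SP c _ _
  have sV : SP (PP c (N + 1) v) := PP_SP c _ _
  have sW : SP (fun y => (v y - PP c (N + 1) v y) * F y) := (hv.sub sV).mul sF
  have key : (fun x => DD c (N + 3) (fun y => v y * F y) x - v x * DD c (N + 3) F x) =
      Kop H (lam (N + 3)) (fun y => (v y - PP c (N + 1) v y) * F y) := by
    ext x
    rw [vanish1, mul_zero, sub_zero, ← DD_Kop c kH sW]
    have : (fun y => (v y - PP c (N + 1) v y) * F y) =
        fun y => v y * F y - PP c (N + 1) v y * F y := by ext y; ring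
    rw [this, DD_sub c _ (hv.mul sF) (sV.mul sF), vanish2, sub_zero]
  rw [key]
  refine (Kop_Lp kH _ sW hp).trans ?_
  have e1 : LpNormT p (fun y => (v y - PP c (N + 1) v y) * F y) ≤
      LpNormT p₁ (fun y => v y - PP c (N + 1) v y) * LpNormT p₂ F :=
    LpNormT_holder hH (hv.sub sV).cont sF.cont
  have e2 : LpNormT p₂ F ≤ (∫⁻ y, ‖X y‖ₑ) * LpNormT p₂ (deriv f) := by
    have : F = Kop X (lam (N + 1)) (deriv f) := by
      ext x; exact PP_Kop c (Nat.succ_ne_zero N) kX hf.deriv x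
    rw [this]
    exact Kop_Lp kX _ hf.deriv hp₂
  have e3 : LpNormT p₁ (fun y => v y - PP c (N + 1) v y) ≤
      (∫⁻ y, ‖B y‖ₑ) * ∑' i, ENNReal.ofReal (lam (N + 1 + i)) * LpNormT p₁ (DD c (N + 1 + i) (deriv v)) := by
    refine (tail c hv hp₁ (N + 1)).trans ?_
    rw [← ENNReal.tsum_mul_left]
    refine ENNReal.tsum_le_tsum fun i => ?_
    have : DD c (N + 1 + i) v = fun x => (lam (N + 1 + i) : ℂ) *
        Kop B (lam (N + 1 + i)) (DD c (N + 1 + i) (deriv v)) x := by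
      ext x; exact DD_bern c (by omega) kB hv x
    rw [this, LpNormT_cmul]
    have e4 : ‖(lam (N + 1 + i) : ℂ)‖ₑ = ENNReal.ofReal (lam (N + 1 + i)) := by
      rw [← ofReal_norm, Complex.norm_real, Real.norm_of_nonneg (lam_pos _).le]
    rw [e4, mul_left_comm]
    gcongr
    exact Kop_Lp kB _ (DD_SP c _ _) hp₁
  calc _ ≤ (K1 : ℝ≥0∞) * (((∫⁻ y, ‖B y‖ₑ) * ∑' i, ENNReal.ofReal (lam (N + 1 + i)) *
        LpNormT p₁ (DD c (N + 1 + i) (deriv v))) * ((∫⁻ y, ‖X y‖ₑ) * LpNormT p₂ (deriv f))) := by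
        gcongr
        exact e1.trans (mul_le_mul' e3 e2)
    _ = _ := by ring

lemma toC_deriv {v : ℝ → ℝ} (hv : ContDiff ℝ (⊤ : ℕ∞) v) : toC (deriv v) = deriv (toC v) := by
  ext x
  have := ((hv.differentiable (by simp)) x).hasDerivAt.ofReal_comp
  exact this.deriv.symm

lemma split_comm (c : LPCutoff) (n : ℕ) {v f g : ℝ → ℂ} (hv : SP v) (hf : SP f) (hg : SP g) (x : ℝ) :
    DD c n (fun y => v y * deriv f y) x - v x * DD c n (deriv f) x =
    (DD c n (fun y => v y * deriv (fun y => f y - g y) y) x -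
      v x * DD c n (deriv (fun y => f y - g y)) x) +
    (DD c n (fun y => v y * deriv g y) x - v x * DD c n (deriv g) x) := by
  have h1 : deriv (fun y => f y - g y) = fun y => deriv f y - deriv g y := by
    ext y
    exact ((hf.diff y).hasDerivAt.sub (hg.diff y).hasDerivAt).deriv
  have h2 : (fun y => v y * (deriv f y - deriv g y)) = fun y => v y * deriv f y - v y * deriv g y := by
    ext y; ring
  simp only [h1]
  rw [h2, DD_sub c n (hv.mul hf.deriv) (hv.mul hg.deriv), DD_sub c n hf.deriv hg.deriv]
  ring

lemma pointwise (c : LPCutoff) : ∃ K : ℝ≥0, ∀ (k : ℕ) (v f : ℝ → ℂ), SP v → SP f → ∀ V : ℝ≥0,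
    (∀ x, ‖deriv v x‖₊ ≤ V) →
    ∀ p p₁ p₂ : ℝ≥0∞, 1 ≤ p → 1 ≤ p₁ → 1 ≤ p₂ → ENNReal.HolderTriple p₁ p₂ p →
    wt k * LpNormT p (fun x => DD c k (fun y => v y * deriv f y) x - v x * DD c k (deriv f) x) ≤
      K * V * (∑' i, (2⁻¹ : ℝ≥0∞) ^ i * (wt (k - 2 + i) * LpNormT p (DD c (k - 2 + i) f))) +
      K * LpNormT p₂ (deriv f) *
        (∑' i, (2⁻¹ : ℝ≥0∞) ^ i * LpNormT p₁ (DD c (k - 2 + i) (deriv v))) := by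
  obtain ⟨K1, h1⟩ := high c
  obtain ⟨K2, h2⟩ := low c
  refine ⟨4 * K1 + 4 * K2, ?_⟩
  intro k v f hv hf V hV p p₁ p₂ hp hp₁ hp₂ hH
  set g := PP c (k - 2) f with hg
  have sg : SP g := PP_SP c _ _
  have hc : ∀ {u : ℝ → ℂ}, Continuous (fun x => DD c k (fun y => v y * deriv u y) x - v x * DD c k (deriv u) x) :=
    fun {u} => (DD_SP c k _).cont.sub (hv.cont.mul (DD_SP c k _).cont)
  have e0 : LpNormT p (fun x => DD c k (fun y => v y * deriv f y) x - v x * DD c k (deriv f) x) ≤ _ :=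
    (le_of_eq (congrArg (LpNormT p) (funext fun x => split_comm c k hv hf sg x))).trans
      (LpNormT_add hp (hc (u := fun y => f y - g y)) (hc (u := g)))
  have e1 := h1 k v (fun y => f y - g y) hv (hf.sub sg) V hV p hp
  have e1' : wt k * LpNormT p (fun y => f y - g y) ≤
      4 * ∑' i, (2⁻¹ : ℝ≥0∞) ^ i * (wt (k - 2 + i) * LpNormT p (DD c (k - 2 + i) f)) := by
    refine (mul_le_mul_right (tail c hf hp (k - 2)) _).trans ?_
    rw [← ENNReal.tsum_mul_left, ← ENNReal.tsum_mul_left]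
    refine ENNReal.tsum_le_tsum fun i => ?_
    refine (mul_le_mul_left (wt_wt k i) _).trans (le_of_eq ?_)
    ring
  have e2 : wt k * LpNormT p (fun x => DD c k (fun y => v y * deriv g y) x - v x * DD c k (deriv g) x) ≤
      4 * K2 * LpNormT p₂ (deriv f) *
        (∑' i, (2⁻¹ : ℝ≥0∞) ^ i * LpNormT p₁ (DD c (k - 2 + i) (deriv v))) := by
    by_cases hk : k ≤ 2
    · have g0 : g = fun _ => 0 := by rw [hg, show k - 2 = 0 by omega, PP_zero]
      have d0 : deriv g = fun _ => 0 := by rw [g0]; ext y; simp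
      have z : ∀ x, DD c k (fun _ => 0) x = 0 := by
        intro x
        have := DD_sub c k (SP.const 0) (SP.const 0) x
        simpa using this
      have : (fun x => DD c k (fun y => v y * deriv g y) x - v x * DD c k (deriv g) x) = fun _ => 0 := by
        ext x
        rw [d0]
        simp only [mul_zero, z, sub_zero]
      rw [this]
      have : LpNormT p (fun _ => 0) = 0 := eLpNorm_zero
      rw [this, mul_zero]
      exact zero_le
    · obtain ⟨N, rfl⟩ : ∃ N, k = N + 3 := ⟨k - 3, by omega⟩
      have hN : N + 3 - 2 = N + 1 := by omega
      have := h2 N v f hv hf p p₁ p₂ hp hp₁ hp₂ hH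
      rw [← hN] at this
      refine (mul_le_mul_right this _).trans ?_
      calc _ = K2 * LpNormT p₂ (deriv f) * (wt (N + 3) * ∑' i, ENNReal.ofReal (lam (N + 3 - 2 + i)) *
            LpNormT p₁ (DD c (N + 3 - 2 + i) (deriv v))) := by ring
        _ ≤ K2 * LpNormT p₂ (deriv f) * (4 * ∑' i, (2⁻¹ : ℝ≥0∞) ^ i *
            LpNormT p₁ (DD c (N + 3 - 2 + i) (deriv v))) := by
          refine mul_le_mul_right ?_ _
          rw [← ENNReal.tsum_mul_left, ← ENNReal.tsum_mul_left]
          refine ENNReal.tsum_le_tsum fun i => ?_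
          rw [← mul_assoc, ← mul_assoc]
          exact mul_le_mul_left (wt_lam _ i) _
        _ = _ := by ring
  set S1 := ∑' i, (2⁻¹ : ℝ≥0∞) ^ i * (wt (k - 2 + i) * LpNormT p (DD c (k - 2 + i) f))
  set S2 := ∑' i, (2⁻¹ : ℝ≥0∞) ^ i * LpNormT p₁ (DD c (k - 2 + i) (deriv v))
  push_cast
  calc _ ≤ wt k * _ := mul_le_mul_right e0 _
    _ = wt k * _ + wt k * _ := mul_add _ _ _
    _ ≤ wt k * (K1 * (V * LpNormT p (fun y => f y - g y))) + 4 * K2 * LpNormT p₂ (deriv f) * S2 :=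
      add_le_add (mul_le_mul_right e1 _) e2
    _ = K1 * V * (wt k * LpNormT p (fun y => f y - g y)) + 4 * K2 * LpNormT p₂ (deriv f) * S2 := by ring
    _ ≤ K1 * V * (4 * S1) + 4 * K2 * LpNormT p₂ (deriv f) * S2 :=
      add_le_add (mul_le_mul_right e1' _) le_rfl
    _ = 4 * K1 * V * S1 + 4 * K2 * LpNormT p₂ (deriv f) * S2 := by ring
    _ ≤ _ := by
      gcongr
      · exact le_self_add
      · exact le_add_self

lemma final_est (c : LPCutoff) (p p₁ p₂ r : ℝ≥0∞)
    (hr : 1 ≤ r) (hp : 1 ≤ p) (hpp₁ : p ≤ p₁) (hp₂ : 1 / p₂ = 1 / p - 1 / p₁) :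
    ∃ C : ℝ, 0 < C ∧ ∀ v f : ℝ → ℝ,
      ContDiff ℝ (⊤ : ℕ∞) v → Function.Periodic v (2 * Real.pi) →
      ContDiff ℝ (⊤ : ℕ∞) f → Function.Periodic f (2 * Real.pi) →
      lrNormE r (fun k => (2:ℝ≥0∞) ^ ((k:ℤ) - 1) * LpNormT p (commutatorLP c ((k:ℤ) - 1) v f))
        ≤ ENNReal.ofReal C *
            (supNormE (deriv v) * besovNormE c 1 p r (toC f) +
              LpNormT p₂ (toC (deriv f)) * besovNormE c 0 p₁ r (toC (deriv v))) := by
  obtain ⟨K, hK⟩ := pointwise c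
  refine ⟨6 * K + 1, by positivity, fun v f hv pv hf pf => ?_⟩
  have hp₁ : 1 ≤ p₁ := hp.trans hpp₁
  simp only [one_div] at hp₂
  have hH : ENNReal.HolderTriple p₁ p₂ p := by
    constructor
    rw [hp₂, add_tsub_cancel_of_le (ENNReal.inv_le_inv.2 hpp₁)]
  have h2 : 1 ≤ p₂ := by
    rw [← ENNReal.inv_le_one, hp₂]
    exact tsub_le_self.trans (ENNReal.inv_le_one.2 hp)
  have sv : SP (toC v) := SP.toC hv pv
  have sf : SP (toC f) := SP.toC hf pf
  have hdv := toC_deriv hv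
  have hdf := toC_deriv hf
  have hfin : supNormE (deriv v) ≠ ∞ := by
    obtain ⟨M, hM⟩ := sv.deriv.bdd
    refine ne_top_of_le_ne_top (b := ENNReal.ofReal M) ENNReal.ofReal_ne_top (iSup_le fun x => ?_)
    have := hM x
    rw [← hdv] at this
    simp only [toC, Complex.norm_real] at this
    change ‖deriv v x‖ₑ ≤ _
    rw [← ofReal_norm]
    exact ENNReal.ofReal_le_ofReal this
  set V := (supNormE (deriv v)).toNNReal with hVd
  have hVe : (V : ℝ≥0∞) = supNormE (deriv v) := ENNReal.coe_toNNReal hfin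
  have hV : ∀ x, ‖deriv (toC v) x‖₊ ≤ V := by
    intro x
    rw [← ENNReal.coe_le_coe, hVe, ← hdv]
    simp only [toC, Complex.nnnorm_real]
    exact le_iSup (fun x => (‖deriv v x‖₊ : ℝ≥0∞)) x
  have hcomm : ∀ k : ℕ, commutatorLP c ((k:ℤ) - 1) v f =
      fun x => DD c k (fun y => toC v y * deriv (toC f) y) x - toC v x * DD c k (deriv (toC f)) x := by
    intro k
    ext x
    unfold commutatorLP
    rw [block_eq, block_eq, hdf]
    have : (toC fun y => v y * deriv f y) = fun y => toC v y * deriv (toC f) y := by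
      ext y
      rw [← hdf]
      simp [toC]
    rw [this]
    rfl
  set a : ℕ → ℝ≥0∞ := fun n => wt n * LpNormT p (DD c n (toC f)) with ha
  set b : ℕ → ℝ≥0∞ := fun n => LpNormT p₁ (DD c n (deriv (toC v))) with hb
  have ba : besovNormE c 1 p r (toC f) = lrNormE r a := by
    unfold besovNormE
    simp only [wt_eq2, block_eq, ha]
  have bb : besovNormE c 0 p₁ r (toC (deriv v)) = lrNormE r b := by
    unfold besovNormE
    simp only [mul_zero, Real.rpow_zero, ENNReal.ofReal_one, one_mul, block_eq, hb, hdv]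
  rw [ba, bb, ← hVe, hdf]
  set L := LpNormT p₂ (deriv (toC f))
  calc _ ≤ lrNormE r (fun k => K * V * (∑' i, (2⁻¹ : ℝ≥0∞) ^ i * a (k - 2 + i)) +
          K * L * (∑' i, (2⁻¹ : ℝ≥0∞) ^ i * b (k - 2 + i))) := by
        refine lr_mono hr fun k => ?_
        rw [wt_eq, hcomm]
        exact hK k (toC v) (toC f) sv sf V hV p p₁ p₂ hp hp₁ h2 hH
    _ ≤ K * V * (6 * lrNormE r a) + K * L * (6 * lrNormE r b) := by
        refine (lr_add hr _ _).trans ?_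
        rw [lr_smul hr, lr_smul hr]
        exact add_le_add (mul_le_mul_right (lr_conv hr a) _) (mul_le_mul_right (lr_conv hr b) _)
    _ = (6 * K) * (V * lrNormE r a + L * lrNormE r b) := by ring
    _ ≤ _ := by
        refine mul_le_mul_left ?_ _
        rw [ENNReal.ofReal_add (by positivity) (by norm_num), ENNReal.ofReal_mul (by norm_num)]
        simp

/-- The commutator estimate: for `1 ≤ r ≤ ∞`, `1 ≤ p ≤ p₁ ≤ ∞` and `1/p₂ = 1/p - 1/p₁`,
there is `C > 0` such that for all smooth periodic `v, f`,
`‖(2^j ‖[Δ_j,v]∂_x f‖_{L^p})_j‖_{ℓ^r} ≤ C (‖∂_x v‖_{L^∞} ‖f‖_{B^1_{p,r}} + ‖∂_x f‖_{L^{p₂}} ‖∂_x v‖_{B^0_{p₁,r}})`. -/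
theorem commutator_estimate_torus (c : LPCutoff) (p p₁ p₂ r : ℝ≥0∞)
    (hr : 1 ≤ r) (hp : 1 ≤ p) (hpp₁ : p ≤ p₁) (hp₂ : 1 / p₂ = 1 / p - 1 / p₁) :
    ∃ C : ℝ, 0 < C ∧ ∀ v f : ℝ → ℝ,
      ContDiff ℝ (⊤ : ℕ∞) v → Function.Periodic v (2 * Real.pi) →
      ContDiff ℝ (⊤ : ℕ∞) f → Function.Periodic f (2 * Real.pi) →
      lrNormE r (fun k => (2:ℝ≥0∞) ^ ((k:ℤ) - 1) * LpNormT p (commutatorLP c ((k:ℤ) - 1) v f))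
        ≤ ENNReal.ofReal C *
            (supNormE (deriv v) * besovNormE c 1 p r (toC f) +
              LpNormT p₂ (toC (deriv f)) * besovNormE c 0 p₁ r (toC (deriv v))) := by
  exact final_est c p p₁ p₂ r hr hp hpp₁ hp₂
end
end

section
/- There exist constants c₁, c₂ > 0 (depending only on the cutoff χ) such that for every integer j ≥ 4, c₁ ≤ ‖Δ_j h‖_{L^∞(𝕋)} ≤ c₂. -/
open MeasureTheory Filter Function
open scoped ENNReal NNReal

noncomputable section

/-- The `2π`-periodic square wave: `1/2` on `(0,π)`, `-1/2` on `(-π,0)`, `0` on `{-π,0,π}`. -/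
def hFun (x : ℝ) : ℝ :=
  let y := x - 2 * Real.pi * ⌊(x + Real.pi) / (2 * Real.pi)⌋
  if y = 0 ∨ y = -Real.pi then 0 else if 0 < y then 1/2 else -1/2

lemma hFun_pos {x : ℝ} (h0 : 0 < x) (h1 : x < Real.pi) : hFun x = 1/2 := by
  have hp := Real.pi_pos
  have hf : ⌊(x + Real.pi) / (2 * Real.pi)⌋ = 0 := by
    rw [Int.floor_eq_zero_iff]
    constructor
    · positivity
    · rw [div_lt_one (by positivity)]; linarith
  have a : ¬ (x = 0 ∨ x = -Real.pi) := by
    rintro (h | h) <;> linarith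
  simp only [hFun, hf, Int.cast_zero, mul_zero, sub_zero]
  rw [if_neg a, if_pos h0]

lemma hFun_neg {x : ℝ} (h0 : x < 0) (h1 : -Real.pi < x) : hFun x = -1/2 := by
  have hp := Real.pi_pos
  have hf : ⌊(x + Real.pi) / (2 * Real.pi)⌋ = 0 := by
    rw [Int.floor_eq_zero_iff]
    constructor
    · apply div_nonneg <;> linarith
    · rw [div_lt_one (by positivity)]; linarith
  have a : ¬ (x = 0 ∨ x = -Real.pi) := by
    rintro (h | h) <;> linarith
  simp only [hFun, hf, Int.cast_zero, mul_zero, sub_zero]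
  rw [if_neg a, if_neg (by linarith)]

lemma fCoeff_h (ξ : ℤ) (hξ : ξ ≠ 0) :
    fCoeff (toC hFun) ξ
      = -Complex.I * (((1 - Real.cos (Real.pi * ξ)) / ξ : ℝ) : ℂ) := by
  have hp := Real.pi_pos
  set k : ℂ := -Complex.I * ξ with hk
  have hξ' : (ξ : ℂ) ≠ 0 := by exact_mod_cast hξ
  have hk0 : k ≠ 0 := by simp [hk, hξ']
  have e1 : Set.EqOn (fun x : ℝ => Complex.exp (k * x) * (1/2))
      (fun x : ℝ => Complex.exp (-Complex.I * x * ξ) * toC hFun x) (Set.Ioo 0 Real.pi) := by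
    intro x hx
    simp only [toC, hFun_pos hx.1 hx.2, hk]
    push_cast
    congr 2
    ring
  have e2 : Set.EqOn (fun x : ℝ => Complex.exp (k * x) * (-1/2))
      (fun x : ℝ => Complex.exp (-Complex.I * x * ξ) * toC hFun x)
      (Set.Ioo (-Real.pi) 0) := by
    intro x hx
    simp only [toC, hFun_neg hx.2 hx.1, hk]
    push_cast
    congr 2
    ring
  have i1 : IntervalIntegrable (fun x : ℝ => Complex.exp (k * x) * (1/2)) volume 0 Real.pi :=
    Continuous.intervalIntegrable (by fun_prop) _ _
  have i2 : IntervalIntegrable (fun x : ℝ => Complex.exp (k * x) * (-1/2)) volume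
      (-Real.pi) 0 :=
    Continuous.intervalIntegrable (by fun_prop) _ _
  have j1 := i1.congr_uIoo (by rw [Set.uIoo_of_le hp.le]; exact e1)
  have j2 := i2.congr_uIoo (by rw [Set.uIoo_of_le (by linarith)]; exact e2)
  unfold fCoeff
  rw [← intervalIntegral.integral_add_adjacent_intervals j2 j1,
    ← intervalIntegral.integral_congr_Ioo_of_le (by linarith) e2,
    ← intervalIntegral.integral_congr_Ioo_of_le hp.le e1,
    intervalIntegral.integral_mul_const, intervalIntegral.integral_mul_const,
    integral_exp_mul_complex hk0, integral_exp_mul_complex hk0]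
  push_cast
  rw [Complex.cos]
  have a1 : k * (Real.pi : ℂ) = -((Real.pi : ℂ) * ξ) * Complex.I := by rw [hk]; ring
  have a2 : k * (-(Real.pi : ℂ)) = ((Real.pi : ℂ) * ξ) * Complex.I := by rw [hk]; ring
  rw [a1, a2, hk]
  simp only [mul_zero, Complex.exp_zero]
  field_simp
  ring_nf
  simp only [Complex.I_sq]
  ring

lemma phi_even (c : LPCutoff) (x : ℝ) : c.phi (-x) = c.phi x := by
  unfold LPCutoff.phi
  rw [neg_div, c.even, c.even]

lemma phi_abs (c : LPCutoff) (x : ℝ) : c.phi |x| = c.phi x := by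
  rcases abs_choice x with h | h <;> rw [h]
  exact phi_even c x

lemma phi_nonneg (c : LPCutoff) (x : ℝ) : 0 ≤ c.phi x := by
  rw [← phi_abs]
  have := abs_nonneg x
  have := c.decay (Set.mem_Ici.2 (by linarith : 0 ≤ |x|/2)) (Set.mem_Ici.2 this)
    (by linarith)
  unfold LPCutoff.phi
  linarith

lemma phi_le_one (c : LPCutoff) (x : ℝ) : c.phi x ≤ 1 := by
  unfold LPCutoff.phi
  linarith [c.le_one (x/2), c.nonneg x]

lemma phi_supp_s5 (c : LPCutoff) (x : ℝ) (h : c.phi x ≠ 0) : 3/4 < |x| ∧ |x| < 8/3 := by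
  constructor
  · by_contra! hx
    apply h
    have h2 := abs_le.1 hx
    unfold LPCutoff.phi
    rw [c.eq_one x ⟨by linarith, by linarith⟩, c.eq_one (x/2) ⟨by linarith, by linarith⟩]
    ring
  · by_contra! hx
    apply h
    rw [← phi_abs]
    unfold LPCutoff.phi
    have h1 : c.χ |x| = 0 := by
      by_contra hh
      linarith [(c.supp _ hh).2]
    have h2 : c.χ (|x|/2) = 0 := by
      by_contra hh
      linarith [(c.supp _ hh).2]
    rw [h1, h2]; ring

lemma phi_eq_one (c : LPCutoff) (x : ℝ) (h : 4/3 ≤ x) (h' : x ≤ 3/2) : c.phi x = 1 := by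
  unfold LPCutoff.phi
  have h1 : c.χ x = 0 := by
    by_contra hh
    linarith [(c.supp _ hh).2]
  rw [h1, c.eq_one (x/2) ⟨by linarith, by linarith⟩]; ring

/-- The general term. -/
def trm (c : LPCutoff) (N : ℝ) (x : ℝ) (ξ : ℤ) : ℂ :=
  (c.phi (N⁻¹ * ξ) : ℂ) * fCoeff (toC hFun) ξ * Complex.exp (Complex.I * x * ξ)

lemma trm_supp (c : LPCutoff) (N : ℕ) (hN : 0 < N) (x : ℝ) (ξ : ℤ) (h : trm c N x ξ ≠ 0) :
    3/4 * (N:ℝ) < |(ξ:ℝ)| ∧ |(ξ:ℝ)| < 8/3 * N := by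
  have hp : c.phi ((N:ℝ)⁻¹ * ξ) ≠ 0 := by
    intro h0
    apply h
    simp [trm, h0]
  have hN' : (0:ℝ) < N := by exact_mod_cast hN
  obtain ⟨a, b⟩ := phi_supp_s5 c _ hp
  rw [abs_mul, abs_of_pos (inv_pos.2 hN'), inv_mul_eq_div] at a b
  rw [lt_div_iff₀ hN'] at a
  rw [div_lt_iff₀ hN'] at b
  exact ⟨a, b⟩

lemma trm_zero (c : LPCutoff) (N : ℕ) (hN : 0 < N) (x : ℝ) (ξ : ℤ)
    (h : ξ ∉ Finset.Icc (-(3 * N : ℤ)) (3 * N)) : trm c N x ξ = 0 := by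
  by_contra hh
  obtain ⟨_, b⟩ := trm_supp c N hN x ξ hh
  have hN' : (0:ℝ) < N := by exact_mod_cast hN
  have b' := abs_lt.1 b
  apply h
  rw [Finset.mem_Icc]
  constructor
  · have : (-(3 * N) : ℝ) ≤ ξ := by linarith
    exact_mod_cast this
  · have : (ξ : ℝ) ≤ 3 * N := by linarith
    exact_mod_cast this

lemma trm_norm (c : LPCutoff) (N : ℕ) (hN : 0 < N) (x : ℝ) (ξ : ℤ) :
    ‖trm c N x ξ‖ ≤ 8 / (3 * N) := by
  have hN' : (0:ℝ) < N := by exact_mod_cast hN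
  by_cases hh : trm c N x ξ = 0
  · rw [hh, norm_zero]; positivity
  obtain ⟨a, _⟩ := trm_supp c N hN x ξ hh
  have hpos : 0 < |(ξ:ℝ)| := by nlinarith
  have hξ : ξ ≠ 0 := by
    rintro rfl
    simp at hpos
  unfold trm
  rw [fCoeff_h ξ hξ, norm_mul, norm_mul, norm_mul, norm_neg, Complex.norm_I, one_mul,
    Complex.norm_real, Complex.norm_real, Real.norm_eq_abs, Real.norm_eq_abs,
    show Complex.I * (x:ℂ) * ξ = ((x * ξ : ℝ) : ℂ) * Complex.I by push_cast; ring,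
    Complex.norm_exp_ofReal_mul_I, mul_one, abs_of_nonneg (phi_nonneg c _), abs_div]
  have h1 : |1 - Real.cos (Real.pi * ξ)| ≤ 2 := by
    rw [abs_le]
    constructor <;> linarith [Real.neg_one_le_cos (Real.pi * ξ), Real.cos_le_one (Real.pi * ξ)]
  calc _ ≤ 1 * (2 / (3/4 * (N:ℝ))) := by
        gcongr
        exact phi_le_one c _
    _ = _ := by field_simp; norm_num

lemma trm_re (c : LPCutoff) (N : ℕ) (x : ℝ) (ξ : ℤ) (hξ : ξ ≠ 0) :
    (trm c N x ξ).re
      = c.phi ((N:ℝ)⁻¹ * ξ) * ((1 - Real.cos (Real.pi * ξ)) / ξ) * Real.sin (x * ξ) := by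
  unfold trm
  rw [fCoeff_h ξ hξ,
    show Complex.I * (x:ℂ) * ξ = ((x * ξ : ℝ) : ℂ) * Complex.I by push_cast; ring,
    Complex.exp_mul_I, ← Complex.ofReal_cos, ← Complex.ofReal_sin,
    show ∀ a b s t : ℝ, (a : ℂ) * (-Complex.I * (b : ℂ)) * ((s : ℂ) + (t : ℂ) * Complex.I)
      = ((a * b * t : ℝ) : ℂ) + ((-(a * b * s) : ℝ) : ℂ) * Complex.I by
        intro a b s t
        push_cast
        linear_combination (-(a:ℂ) * b * t) * Complex.I_sq]
  rw [Complex.add_re, Complex.ofReal_re, Complex.re_ofReal_mul, Complex.I_re, mul_zero, add_zero]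

lemma trm_re_nonneg (c : LPCutoff) (N : ℕ) (hN : 0 < N) (ξ : ℤ) :
    0 ≤ (trm c N ((N:ℝ)⁻¹) ξ).re := by
  by_cases hh : trm c N ((N:ℝ)⁻¹) ξ = 0
  · rw [hh]; simp
  have hN' : (0:ℝ) < N := by exact_mod_cast hN
  obtain ⟨a, b⟩ := trm_supp c N hN _ ξ hh
  have hpos : 0 < |(ξ:ℝ)| := by nlinarith
  have hξ : ξ ≠ 0 := by
    rintro rfl
    simp at hpos
  rw [trm_re c N _ ξ hξ, mul_assoc]
  apply mul_nonneg (phi_nonneg c _)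
  have h1 : 0 ≤ 1 - Real.cos (Real.pi * ξ) := by linarith [Real.cos_le_one (Real.pi * ξ)]
  rw [div_mul_eq_mul_div, mul_div_assoc]
  apply mul_nonneg h1
  have hb : (N:ℝ)⁻¹ * |(ξ:ℝ)| ≤ Real.pi := by
    rw [inv_mul_eq_div, div_le_iff₀ hN']
    nlinarith [Real.pi_gt_three]
  have hs : 0 ≤ Real.sin ((N:ℝ)⁻¹ * |(ξ:ℝ)|) :=
    Real.sin_nonneg_of_nonneg_of_le_pi (by positivity) hb
  have : Real.sin ((N:ℝ)⁻¹ * ξ) / ξ = Real.sin ((N:ℝ)⁻¹ * |(ξ:ℝ)|) / |(ξ:ℝ)| := by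
    rcases abs_choice (ξ:ℝ) with h | h <;> rw [h]
    rw [mul_neg, Real.sin_neg, neg_div_neg_eq]
  rw [this]
  positivity

lemma trm_re_lower (c : LPCutoff) (N : ℕ) (hN : 0 < N) (m : ℤ)
    (h1 : 4/3 * (N:ℝ) ≤ ((2 * m + 1 : ℤ) : ℝ)) (h2 : ((2 * m + 1 : ℤ) : ℝ) ≤ 3/2 * N) :
    4 * Real.sin 1 / (3 * N) ≤ (trm c N ((N:ℝ)⁻¹) (2 * m + 1)).re := by
  have hN' : (0:ℝ) < N := by exact_mod_cast hN
  rw [trm_re c N _ _ (by omega)]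
  have hc : Real.cos (Real.pi * ((2 * m + 1 : ℤ) : ℝ)) = -1 := by
    have := Real.cos_int_mul_two_pi_add_pi m
    rw [← this]
    congr 1
    push_cast
    ring
  rw [hc]
  generalize ((2 * m + 1 : ℤ) : ℝ) = y at *
  have hy : 0 < y := by nlinarith
  have t1 : 4/3 ≤ (N:ℝ)⁻¹ * y := by
    rw [inv_mul_eq_div, le_div_iff₀ hN']; exact h1
  have t2 : (N:ℝ)⁻¹ * y ≤ 3/2 := by
    rw [inv_mul_eq_div, div_le_iff₀ hN']; exact h2
  rw [phi_eq_one c _ t1 t2]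
  have hp := Real.pi_gt_three
  have hs : Real.sin 1 ≤ Real.sin ((N:ℝ)⁻¹ * y) :=
    Real.sin_le_sin_of_le_of_le_pi_div_two (by linarith) (by linarith) (by linarith)
  have hs1 : 0 < Real.sin 1 := Real.sin_pos_of_pos_of_lt_pi one_pos (by linarith)
  calc 4 * Real.sin 1 / (3 * N) = 1 * ((1 - -1) / (3/2 * (N:ℝ))) * Real.sin 1 := by
        field_simp; norm_num
    _ ≤ _ := by
        gcongr

lemma sum_lower (c : LPCutoff) (N : ℕ) (hN : 16 ≤ N) :
    Real.sin 1 / 18 ≤ (∑ ξ ∈ Finset.Icc (-(3 * N : ℤ)) (3 * N), trm c N ((N:ℝ)⁻¹) ξ).re := by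
  have hN0 : 0 < N := by omega
  have hN' : (0:ℝ) < N := by exact_mod_cast hN0
  have hs1 : 0 < Real.sin 1 := Real.sin_pos_of_pos_of_lt_pi one_pos (by linarith [Real.pi_gt_three])
  set m0 : ℤ := (2 * N + 2) / 3 with hm0
  set k : ℤ := (N / 12 : ℤ) with hk
  let T : Finset ℤ := (Finset.Ico m0 (m0 + k)).image (fun m => 2 * m + 1)
  have hT : T ⊆ Finset.Icc (-(3 * N : ℤ)) (3 * N) := by
    intro y hy
    simp only [T, Finset.mem_image, Finset.mem_Ico] at hy
    obtain ⟨m, hm, rfl⟩ := hy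
    rw [Finset.mem_Icc]
    omega
  rw [Complex.re_sum]
  refine le_trans ?_ (Finset.sum_le_sum_of_subset_of_nonneg hT
    (fun i _ _ => trm_re_nonneg c N hN0 i))
  have hinj : Function.Injective (fun m : ℤ => 2 * m + 1) := by
    intro a b h
    simp only at h
    omega
  rw [Finset.sum_image hinj.injOn]
  have hlow : ∀ m ∈ Finset.Ico m0 (m0 + k),
      4 * Real.sin 1 / (3 * N) ≤ (trm c N ((N:ℝ)⁻¹) (2 * m + 1)).re := by
    intro m hm
    rw [Finset.mem_Ico] at hm
    have a1 : 4 * (N:ℤ) ≤ 3 * (2 * m + 1) := by omega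
    have a2 : 2 * (2 * m + 1) ≤ 3 * (N:ℤ) := by omega
    have a1' : 4 * (N:ℝ) ≤ 3 * ((2 * m + 1 : ℤ) : ℝ) := by exact_mod_cast a1
    have a2' : 2 * ((2 * m + 1 : ℤ) : ℝ) ≤ 3 * (N:ℝ) := by exact_mod_cast a2
    exact trm_re_lower c N hN0 m (by linarith) (by linarith)
  refine le_trans ?_ (Finset.card_nsmul_le_sum _ _ _ hlow)
  rw [Int.card_Ico, nsmul_eq_mul]
  have hcard : (N:ℝ) / 24 ≤ ((m0 + k - m0).toNat : ℝ) := by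
    have : N ≤ 24 * (m0 + k - m0).toNat := by omega
    have : (N:ℝ) ≤ 24 * ((m0 + k - m0).toNat : ℝ) := by exact_mod_cast this
    linarith
  calc Real.sin 1 / 18 = (N:ℝ) / 24 * (4 * Real.sin 1 / (3 * N)) := by field_simp; norm_num
    _ ≤ _ := by gcongr

lemma sum_upper (c : LPCutoff) (N : ℕ) (hN : 16 ≤ N) (x : ℝ) :
    ‖∑ ξ ∈ Finset.Icc (-(3 * N : ℤ)) (3 * N), trm c N x ξ‖ ≤ 20 := by
  have hN0 : 0 < N := by omega
  have hN' : (0:ℝ) < N := by exact_mod_cast hN0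
  refine (norm_sum_le_of_le _ (fun i _ => trm_norm c N hN0 x i)).trans ?_
  rw [Finset.sum_const, Int.card_Icc, nsmul_eq_mul]
  have : ((3 * N + 1 - -(3 * N) : ℤ).toNat : ℝ) ≤ 7 * N := by
    have : (3 * N + 1 - -(3 * N) : ℤ).toNat ≤ 7 * N := by omega
    exact_mod_cast this
  calc _ ≤ (7 * N : ℝ) * (8 / (3 * N)) := by gcongr
    _ ≤ 20 := by field_simp; norm_num

lemma block_eq_s5 (c : LPCutoff) (n : ℕ) (x : ℝ) :
    LPblock c n (toC hFun) x = ((1 / (2 * Real.pi) : ℝ) : ℂ) *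
      ∑ ξ ∈ Finset.Icc (-(3 * (2 ^ n : ℕ) : ℤ)) (3 * (2 ^ n : ℕ)), trm c (2 ^ n : ℕ) x ξ := by
  unfold LPblock
  rw [if_neg (by omega), ← tsum_eq_sum (L := SummationFilter.unconditional ℤ) (fun b hb => trm_zero c (2 ^ n) (by positivity) x b hb)]
  unfold trm
  push_cast
  simp only [zpow_neg, zpow_natCast]

/-- There are constants `c₁, c₂ > 0` (depending only on the cutoff) such that
`c₁ ≤ ‖Δ_j h‖_{L^∞(𝕋)} ≤ c₂` for every `j ≥ 4`. -/
theorem block_squareWave_bounds (c : LPCutoff) :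
    ∃ c₁ c₂ : ℝ, 0 < c₁ ∧ 0 < c₂ ∧ ∀ j : ℤ, 4 ≤ j →
      ENNReal.ofReal c₁ ≤ supNormE (LPblock c j (toC hFun)) ∧
      supNormE (LPblock c j (toC hFun)) ≤ ENNReal.ofReal c₂ := by
  have hp := Real.pi_gt_three
  have hs1 : 0 < Real.sin 1 := Real.sin_pos_of_pos_of_lt_pi one_pos (by linarith)
  refine ⟨1 / (2 * Real.pi) * (Real.sin 1 / 18), 20, by positivity, by norm_num, ?_⟩
  intro j hj
  obtain ⟨n, rfl⟩ := Int.eq_ofNat_of_zero_le (by omega : 0 ≤ j)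
  have hn : 4 ≤ n := by omega
  have hN : 16 ≤ 2 ^ n := by
    calc 16 = 2 ^ 4 := by norm_num
      _ ≤ 2 ^ n := Nat.pow_le_pow_right (by norm_num) hn
  have hpp : ‖((1 / (2 * Real.pi) : ℝ) : ℂ)‖ = 1 / (2 * Real.pi) := by
    rw [Complex.norm_real, Real.norm_of_nonneg (by positivity)]
  constructor
  · refine le_trans ?_ (le_iSup (fun x => (‖LPblock c n (toC hFun) x‖₊ : ℝ≥0∞))
      (((2 ^ n : ℕ) : ℝ)⁻¹))
    rw [← enorm_eq_nnnorm, ← ofReal_norm]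
    apply ENNReal.ofReal_le_ofReal
    rw [block_eq_s5, norm_mul, hpp]
    gcongr
    exact (sum_lower c _ hN).trans (Complex.re_le_norm _)
  · refine iSup_le fun x => ?_
    rw [← enorm_eq_nnnorm, ← ofReal_norm]
    apply ENNReal.ofReal_le_ofReal
    rw [block_eq_s5, norm_mul, hpp]
    have h1 : 1 / (2 * Real.pi) ≤ 1 := by
      rw [div_le_one (by positivity)]; linarith
    calc _ ≤ 1 * (20 : ℝ) := by
          gcongr
          exact sum_upper c _ hN x
      _ = 20 := one_mul _
end
end
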